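/- Let W_S be a finite Coxeter group with connected Coxeter graph, let A_S be the corresponding Artin-Tits group, and let X be a nonempty proper subset of S. If the pair (W_X, W_S) satisfies Property ⋆_W, then the standard parabolic subgroup A_X is conjugacy stable in A_S. -/

import Mathlib

namespace ArtinTits

variable {B : Type*}

/-- The alternating product `a b a b ⋯` with `m` factors, starting with `a`. -/
def altProd {G : Type*} [Monoid G] (a b : G) : ℕ → G
  | 0 => 1
  | n + 1 => a * altProd b a n

/-- The braid relations defining the Artin–Tits group of a Coxeter matrix:
`Π(σ_s, σ_t; m_{s,t}) = Π(σ_t, σ_s; m_{s,t})` whenever `m_{s,t} ≠ ∞` (here `∞` is coded by `0`). -/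
def artinRelationsSet (M : CoxeterMatrix B) : Set (FreeGroup B) :=
  {r | ∃ s t : B, M s t ≠ 0 ∧
    r = altProd (FreeGroup.of s) (FreeGroup.of t) (M s t) *
        (altProd (FreeGroup.of t) (FreeGroup.of s) (M s t))⁻¹}

/-- The Artin–Tits group of a Coxeter matrix. -/
abbrev ArtinGroup (M : CoxeterMatrix B) : Type _ := PresentedGroup (artinRelationsSet M)

/-- The standard generator `σ_s` of the Artin–Tits group. -/
def σ (M : CoxeterMatrix B) (s : B) : ArtinGroup M := PresentedGroup.of s

/-- The standard parabolic subgroup `A_X` of the Artin–Tits group. -/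
def AP (M : CoxeterMatrix B) (X : Set B) : Subgroup (ArtinGroup M) :=
  Subgroup.closure (σ M '' X)

/-- The standard parabolic subgroup `W_X` of the Coxeter group. -/
def WP (M : CoxeterMatrix B) (X : Set B) : Subgroup M.Group :=
  Subgroup.closure (M.simple '' X)

/-- A subgroup `H ≤ G` is conjugacy stable if any two elements of `H` which are conjugate
in `G` are already conjugate by an element of `H`. -/
def IsConjugacyStable {G : Type*} [Group G] (H : Subgroup G) : Prop :=
  ∀ a b : G, a ∈ H → b ∈ H → (∃ g : G, g⁻¹ * a * g = b) → ∃ h ∈ H, h⁻¹ * a * h = b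

/-- Property `⋆_W` for the pair `(W_X, W_S)`. -/
def StarW (M : CoxeterMatrix B) (X : Set B) : Prop :=
  ∀ Y₁ Y₂ : Set B, Y₁ ⊆ X → Y₂ ⊆ X → ∀ w : M.Group,
    (fun x => w⁻¹ * x * w) '' (M.simple '' Y₁) = M.simple '' Y₂ →
    ∃ v ∈ WP M X, ∀ y ∈ Y₁, v⁻¹ * M.simple y * v = w⁻¹ * M.simple y * w

/-- Property `⋆_A` for the pair `(A_X, A_S)`. -/
def StarA (M : CoxeterMatrix B) (X : Set B) : Prop :=
  ∀ Y₁ Y₂ : Set B, Y₁ ⊆ X → Y₂ ⊆ X → ∀ g : ArtinGroup M,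
    (fun x => g⁻¹ * x * g) '' (σ M '' Y₁) = σ M '' Y₂ →
    ∃ h ∈ AP M X, ∀ y ∈ Y₁, h⁻¹ * σ M y * h = g⁻¹ * σ M y * g

/-- Adjacency in the Coxeter graph: `s` and `t` are joined by an edge iff `m_{s,t} ≥ 3`
(where the value `0` codes `∞`, which also gives an edge). -/
def Adj (M : CoxeterMatrix B) (s t : B) : Prop := s ≠ t ∧ M s t ≠ 2

/-- `s` and `t` are connected by a path of the Coxeter graph staying inside `X`. -/
def ReachIn (M : CoxeterMatrix B) (X : Set B) (s t : B) : Prop :=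
  Relation.ReflTransGen (fun a b => a ∈ X ∧ b ∈ X ∧ Adj M a b) s t

/-- The Coxeter graph induced on `X` is connected. -/
def ConnectedIn (M : CoxeterMatrix B) (X : Set B) : Prop :=
  ∀ s ∈ X, ∀ t ∈ X, ReachIn M X s t

/-- The Coxeter matrix `M` restricted to `X` is of the type of the Coxeter matrix `M'`,
i.e. there is a bijection transporting one to the other. -/
def IsOfType {B' : Type*} (M : CoxeterMatrix B) (X : Set B) (M' : CoxeterMatrix B') : Prop :=
  ∃ e : X ≃ B', ∀ a b : X, M a.val b.val = M' (e a) (e b)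

/-- The Coxeter matrix of type `Bₙ` with the paper's labelling: vertices `0, …, n-1`
(representing `s_1, …, s_n`), `m_{s_1, s_2} = 4` and `m_{s_i, s_{i+1}} = 3` for `i ≥ 2`. -/
def Bmat (n : ℕ) : CoxeterMatrix (Fin n) where
  M := Matrix.of fun i j : Fin n ↦
    if i = j then 1
      else (if (i.val = 0 ∧ j.val = 1) ∨ (j.val = 0 ∧ i.val = 1) then 4
        else (if (j : ℕ) + 1 = i ∨ (i : ℕ) + 1 = j then 3 else 2))
  isSymm := by unfold Matrix.IsSymm; aesop
  diagonal := by simp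
  off_diagonal := by aesop

/-- The Coxeter matrix of type `Dₙ` with the paper's labelling: vertices `0, …, n-1`
(representing `s_1, …, s_n`), with edges `{s_1, s_3}`, `{s_2, s_3}` and `{s_i, s_{i+1}}`
for `i ≥ 3`, all labelled `3`. -/
def Dmat (n : ℕ) : CoxeterMatrix (Fin n) where
  M := Matrix.of fun i j : Fin n ↦
    if i = j then 1
      else (if (i.val = 0 ∧ j.val = 2) ∨ (j.val = 0 ∧ i.val = 2) then 3
        else (if i.val = 0 ∨ j.val = 0 then 2
          else (if (j : ℕ) + 1 = i ∨ (i : ℕ) + 1 = j then 3 else 2)))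
  isSymm := by unfold Matrix.IsSymm; aesop
  diagonal := by simp
  off_diagonal := by aesop

end ArtinTits


namespace ArtinTits

section Exchange

variable {B W : Type*} [Group W] {M : CoxeterMatrix B} (cs : CoxeterSystem M W)

lemma endmul {Z : Type*} (f g : Function.End Z) (x : Z) : (f * g) x = f (g x) := rfl

open Classical in
/-- Bourbaki's permutation representation (as a self-map). -/
noncomputable def etaGen (i : B) : Function.End (W × ZMod 2) :=
  fun p => (cs.simple i * p.1 * cs.simple i, p.2 + if p.1 = cs.simple i then 1 else 0)

open Classical in
lemma etaGen_pow (i j : B) (n : ℕ) (x : W) (e : ZMod 2) :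
    ((etaGen cs i * etaGen cs j) ^ n) (x, e) =
      ((cs.simple i * cs.simple j) ^ n * x * ((cs.simple i * cs.simple j) ^ n)⁻¹,
        e + ∑ k ∈ Finset.range (2 * n),
          if x = cs.simple j * (cs.simple i * cs.simple j) ^ k then 1 else 0) := by
  induction n with
  | zero => simp; rfl
  | succ n ih =>
    rw [pow_succ', endmul, ih, endmul]
    set c := cs.simple i * cs.simple j with hc
    have hj : cs.simple j * cs.simple j = 1 := cs.simple_mul_simple_self j
    have hi : cs.simple i * cs.simple i = 1 := cs.simple_mul_simple_self i
    have hcinv : c⁻¹ = cs.simple j * cs.simple i := by simp [hc]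
    have hkey : ∀ k : ℕ, (c ^ k)⁻¹ * cs.simple j = cs.simple j * c ^ k := by
      intro k
      induction k with
      | zero => simp
      | succ k ihk =>
        rw [pow_succ, mul_inv_rev, mul_assoc, ihk, hcinv, ← mul_assoc]
        have : c ^ k * c = c * c ^ k := by rw [← pow_succ', pow_succ]
        rw [this]
        simp only [hc, mul_assoc]
    have e1 : (c ^ n * x * (c ^ n)⁻¹ = cs.simple j) ↔ x = cs.simple j * c ^ (2 * n) := by
      have : (c ^ n)⁻¹ * cs.simple j * c ^ n = cs.simple j * c ^ (2 * n) := by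
        rw [hkey, mul_assoc, ← pow_add, two_mul]
      rw [← this]
      constructor
      · intro h; rw [← h]; group
      · intro h; rw [h]; group
    have e2 : (cs.simple j * (c ^ n * x * (c ^ n)⁻¹) * cs.simple j = cs.simple i) ↔
        x = cs.simple j * c ^ (2 * n + 1) := by
      have : (c ^ n)⁻¹ * (cs.simple j * cs.simple i * cs.simple j) * c ^ n =
          cs.simple j * c ^ (2 * n + 1) := by
        rw [mul_assoc (cs.simple j), ← hc, ← mul_assoc, hkey, mul_assoc, mul_assoc, ← pow_succ',
          ← pow_add]
        congr 2; ring
      rw [← this]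
      constructor
      · intro h; rw [← h]; simp only [← mul_assoc]; simp [mul_assoc]
      · intro h; rw [h]; simp only [← mul_assoc]; simp [mul_assoc]
    simp only [etaGen, e1, e2]
    refine Prod.ext ?_ ?_
    · simp only [pow_succ', mul_inv_rev, hcinv]
      simp only [hc, mul_assoc]
    · simp only
      rw [show 2 * (n + 1) = 2 * n + 1 + 1 by ring, Finset.sum_range_succ, Finset.sum_range_succ]
      simp only [add_assoc]

lemma etaGen_liftable : M.IsLiftable (etaGen cs) := by
  classical
  intro i j
  funext p
  obtain ⟨x, e⟩ := p
  rw [etaGen_pow]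
  have h : (cs.simple i * cs.simple j) ^ (M i j) = 1 := cs.simple_mul_simple_pow i j
  rw [two_mul, Finset.sum_range_add]
  simp only [pow_add, h, one_mul, mul_one, inv_one]
  rw [CharTwo.add_self_eq_zero, add_zero]
  rfl

noncomputable def eta : W →* Function.End (W × ZMod 2) :=
  cs.lift ⟨etaGen cs, etaGen_liftable cs⟩

lemma eta_simple (i : B) : eta cs (cs.simple i) = etaGen cs i :=
  cs.lift_apply_simple (etaGen_liftable cs) i

lemma eta_word (ω : List B) (x : W) (e : ZMod 2) :
    ∃ n : ℕ, (eta cs (cs.wordProd ω)) (x, e) =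
      (cs.wordProd ω * x * (cs.wordProd ω)⁻¹, e + n) ∧ (x ∉ cs.rightInvSeq ω → n = 0) := by
  classical
  induction ω with
  | nil => refine ⟨0, ?_, fun _ => rfl⟩; simp; rfl
  | cons i ω ih =>
    obtain ⟨n, h1, h2⟩ := ih
    rw [cs.wordProd_cons, map_mul, endmul, h1, eta_simple]
    refine ⟨n + if cs.wordProd ω * x * (cs.wordProd ω)⁻¹ = cs.simple i then 1 else 0, ?_, ?_⟩
    · simp only [etaGen]
      refine Prod.ext ?_ ?_
      · simp [mul_assoc]
      · simp only [Nat.cast_add, Nat.cast_ite, Nat.cast_one, Nat.cast_zero, add_assoc]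
    · intro hx
      rw [CoxeterSystem.rightInvSeq, List.mem_cons, not_or] at hx
      rw [h2 hx.2, if_neg]
      intro h
      apply hx.1
      rw [← h]; group

/-- Right exchange condition. -/
lemma exchange_right (ω : List B) (i : B)
    (h : cs.length (cs.wordProd ω * cs.simple i) < cs.length (cs.wordProd ω)) :
    ∃ k < ω.length, cs.wordProd ω * cs.simple i = cs.wordProd (ω.eraseIdx k) := by
  classical
  suffices hmem : cs.simple i ∈ cs.rightInvSeq ω by
    obtain ⟨k, hk, hk'⟩ := List.mem_iff_getElem.mp hmem
    refine ⟨k, by simpa using hk, ?_⟩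
    rw [← cs.wordProd_mul_getD_rightInvSeq, List.getD_eq_getElem _ 1 hk, hk']
  by_contra hmem
  obtain ⟨n, h1, h2⟩ := eta_word cs ω (cs.simple i) 0
  rw [h2 hmem] at h1
  obtain ⟨ω', hr, hω'⟩ := cs.exists_isReduced (cs.wordProd ω * cs.simple i)
  have hnot : cs.simple i ∉ cs.rightInvSeq ω' := by
    intro hm
    have := (cs.isRightInversion_of_mem_rightInvSeq hr hm).2
    rw [← hω'] at this
    simp at this
    omega
  obtain ⟨n', h3, h4⟩ := eta_word cs ω' (cs.simple i) 1
  rw [h4 hnot, ← hω', map_mul, endmul, eta_simple] at h3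
  have h5 : etaGen cs i (cs.simple i, 1) = (cs.simple i, 0) := by
    simp only [etaGen]
    refine Prod.ext (by simp) ?_
    simp; rfl
  rw [h5, h1] at h3
  have := congrArg Prod.snd h3
  simp at this

/-- Left exchange condition. -/
lemma exchange_left (ω : List B) (i : B)
    (h : cs.length (cs.simple i * cs.wordProd ω) < cs.length (cs.wordProd ω)) :
    ∃ l₁ j l₂, ω = l₁ ++ j :: l₂ ∧ cs.simple i * cs.wordProd ω = cs.wordProd (l₁ ++ l₂) := by
  have h' : cs.length (cs.wordProd ω.reverse * cs.simple i) <
      cs.length (cs.wordProd ω.reverse) := by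
    rw [cs.wordProd_reverse, cs.length_inv, ← cs.length_inv]
    simpa using h
  obtain ⟨k, hk, hk'⟩ := exchange_right cs ω.reverse i h'
  have h3 := congrArg (fun x => x⁻¹) hk'
  simp only [mul_inv_rev, cs.wordProd_reverse, inv_inv, cs.inv_simple] at h3
  rw [← cs.wordProd_reverse, List.eraseIdx_eq_take_drop_succ, List.reverse_append] at h3
  refine ⟨_, ω.reverse[k], _, ?_, h3⟩
  have h4 : ω.reverse = ω.reverse.take k ++ ω.reverse[k] :: ω.reverse.drop (k + 1) := by
    rw [List.getElem_cons_drop, List.take_append_drop]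
  have h5 := congrArg List.reverse h4
  rw [List.reverse_reverse] at h5
  rw [List.reverse_append, List.reverse_cons, List.append_assoc] at h5
  exact h5

end Exchange

end ArtinTits


namespace ArtinTits

section Geom

variable {B : Type*} (M : CoxeterMatrix B)

open Polynomial.Chebyshev

/-- The linear form attached to a generator in the geometric representation. -/
noncomputable def gForm (s : B) : Module.Dual ℝ (B →₀ ℝ) :=
  Finsupp.linearCombination ℝ (fun t => -2 * Real.cos (Real.pi / M s t))

lemma gForm_single (s t : B) :
    gForm M s (Finsupp.single t 1) = -2 * Real.cos (Real.pi / M s t) := by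
  simp [gForm, Finsupp.linearCombination_single]

lemma gForm_self (s : B) : gForm M s (Finsupp.single s 1) = 2 := by
  rw [gForm_single, M.diagonal]; simp

noncomputable def gRefl (s : B) : (B →₀ ℝ) ≃ₗ[ℝ] (B →₀ ℝ) :=
  Module.reflection (gForm_self M s)

lemma sin_ne (m : ℕ) (hm : 3 ≤ m) : Real.sin (2 * Real.pi / m) ≠ 0 := by
  have hm' : (3 : ℝ) ≤ m := by exact_mod_cast hm
  apply ne_of_gt
  apply Real.sin_pos_of_pos_of_lt_pi
  · positivity
  · rw [div_lt_iff₀ (by linarith)]; nlinarith [Real.pi_pos]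

lemma t_eq (s t : B) : (2 * Real.cos (2 * Real.pi / M s t)) =
    gForm M s (Finsupp.single t 1) * gForm M t (Finsupp.single s 1) - 2 := by
  rw [gForm_single, gForm_single, M.symmetric t s, mul_div_assoc, Real.cos_two_mul]; ring

lemma two_cases {m : ℕ} (h0 : m ≠ 0) (h1 : m ≠ 1) : m = 2 ∨ 3 ≤ m := by omega

lemma gRefl_liftable : M.IsLiftable (gRefl M) := by
  intro s t
  by_cases h0 : M s t = 0
  · rw [h0, pow_zero]
  by_cases hst : s = t
  · subst hst
    rw [M.diagonal, pow_one]
    ext1 z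
    exact Module.involutive_reflection (gForm_self M s) z
  have h1 : M s t ≠ 1 := M.off_diagonal s t hst
  apply LinearEquiv.ext
  intro z
  unfold gRefl
  rw [Module.reflection_mul_reflection_pow_apply _ _ _ _ _ (t_eq M s t)]
  rcases two_cases h0 h1 with h2 | h3
  · rw [gForm_single, gForm_single, M.symmetric t s, h2]
    norm_num
    module
  · have hs := sin_ne _ h3
    set φ := 2 * Real.pi / M s t with hφ
    have key : ∀ n : ℤ, (S ℝ n).eval (2 * Real.cos φ) * Real.sin φ = Real.sin ((n + 1) * φ) :=
      fun n => S_two_mul_real_cos φ n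
    have hmφ : (M s t : ℝ) * φ = 2 * Real.pi := by
      rw [hφ]; field_simp
    rcases Nat.even_or_odd' (M s t) with ⟨k, hk | hk⟩
    · have e1 : (((M s t : ℕ) : ℤ) - 2) / 2 = k - 1 := by omega
      have e2 : (((M s t : ℕ) : ℤ) - 1) / 2 = k - 1 := by omega
      have hz : (S ℝ (k - 1)).eval (2 * Real.cos φ) = 0 := by
        have := key (k - 1)
        have h : (((k : ℤ) - 1 : ℤ) + 1 : ℝ) * φ = Real.pi := by
          rw [hk] at hmφ; push_cast at hmφ ⊢; linarith
        rw [h, Real.sin_pi] at this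
        exact (mul_eq_zero.mp this).resolve_right hs
      rw [e1, e2, hz]; simp
    · have e1 : (((M s t : ℕ) : ℤ) - 2) / 2 = k - 1 := by omega
      have e2 : (((M s t : ℕ) : ℤ) - 1) / 2 = k := by omega
      have e3 : (((M s t : ℕ) : ℤ) - 3) / 2 = k - 1 := by omega
      have e4 : (((M s t : ℕ) : ℤ)) / 2 = k := by omega
      have hz : (S ℝ k).eval (2 * Real.cos φ) + (S ℝ (k - 1)).eval (2 * Real.cos φ) = 0 := by
        have h1 := key (k - 1)
        have h2 := key k
        have h : (((k : ℤ) : ℝ) + 1) * φ = 2 * Real.pi - ((((k : ℤ) - 1 : ℤ) : ℝ) + 1) * φ := by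
          rw [hk] at hmφ; push_cast at hmφ ⊢; linarith
        rw [h, Real.sin_two_pi_sub] at h2
        have : ((S ℝ k).eval (2 * Real.cos φ) + (S ℝ (k - 1)).eval (2 * Real.cos φ)) *
          Real.sin φ = 0 := by rw [add_mul, h1, h2]; ring
        exact (mul_eq_zero.mp this).resolve_right hs
      rw [e1, e2, e3, e4, hz]; simp

noncomputable def gRep : M.Group →* ((B →₀ ℝ) ≃ₗ[ℝ] (B →₀ ℝ)) :=
  M.toCoxeterSystem.lift ⟨gRefl M, gRefl_liftable M⟩

lemma gRep_simple (s : B) : gRep M (M.simple s) = gRefl M s :=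
  M.toCoxeterSystem.lift_apply_simple (gRefl_liftable M) s

lemma dvd_of_pow_eq_one (s t : B) (j : ℕ) (h : (M.simple s * M.simple t) ^ j = 1) :
    M s t ∣ j := by
  by_cases hst : s = t
  · subst hst; rw [M.diagonal]; exact one_dvd _
  have h1 : M s t ≠ 1 := M.off_diagonal s t hst
  have h2 := congrArg (fun w => gRep M w (Finsupp.single s 1)) h
  simp only [map_pow, map_mul, gRep_simple, map_one, gRefl] at h2
  rw [Module.reflection_mul_reflection_pow_apply_self _ _ _ _ (t_eq M s t)] at h2
  have hA : (S ℝ j).eval (2 * Real.cos (2 * Real.pi / M s t)) +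
      (S ℝ (j - 1)).eval (2 * Real.cos (2 * Real.pi / M s t)) = 1 := by
    have := DFunLike.congr_fun h2 s
    simpa [Finsupp.single_apply, hst, Ne.symm hst] using this
  have hB : (S ℝ (j - 1)).eval (2 * Real.cos (2 * Real.pi / M s t)) *
      - gForm M t (Finsupp.single s 1) = 0 := by
    have := DFunLike.congr_fun h2 t
    simpa [Finsupp.single_apply, hst, Ne.symm hst] using this
  rw [gForm_single, M.symmetric t s] at hB
  by_cases h0 : M s t = 0
  · rw [h0] at hB ⊢
    simp [S_eval_two] at hB
    simp [hB]
  rcases two_cases h0 h1 with h2 | h3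
  · rw [h2] at hA ⊢
    have e : (2 * Real.cos (2 * Real.pi / (2 : ℕ)) : ℝ) = -2 := by
      rw [show (2 * Real.pi / (2 : ℕ) : ℝ) = Real.pi by push_cast; ring]; simp
    rw [e, S_eval_neg_two, S_eval_neg_two] at hA
    by_contra hodd
    have hodd' : Odd j := by rwa [← Nat.not_even_iff_odd, even_iff_two_dvd]
    obtain ⟨k, rfl⟩ := hodd'
    have e1 : ((2 * k + 1 : ℕ) : ℤ) - 1 = 2 * k := by push_cast; ring
    rw [e1] at hA
    simp [Int.negOnePow_succ, Int.negOnePow_even] at hA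
    linarith
  · have hs := sin_ne _ h3
    have hm' : (3 : ℝ) ≤ M s t := by exact_mod_cast h3
    have hcos : Real.cos (Real.pi / M s t) ≠ 0 := by
      apply ne_of_gt
      apply Real.cos_pos_of_mem_Ioo
      constructor
      · have : 0 < Real.pi / M s t := by positivity
        linarith [Real.pi_pos]
      · rw [div_lt_iff₀ (by linarith)]; nlinarith [Real.pi_pos]
    have hz : (S ℝ (j - 1)).eval (2 * Real.cos (2 * Real.pi / M s t)) = 0 := by
      rcases mul_eq_zero.mp hB with h | h
      · exact h
      · exfalso; apply hcos; linarith
    set φ := 2 * Real.pi / M s t with hφ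
    have k1 := S_two_mul_real_cos φ (j - 1)
    have k2 := S_two_mul_real_cos φ j
    rw [hz] at hA k1
    rw [add_zero] at hA
    rw [hA, one_mul] at k2
    have k3 : Real.sin (j * φ) = 0 := by
      push_cast at k1
      rw [sub_add_cancel] at k1
      linarith
    have k4 : Real.cos (j * φ) = 1 := by
      push_cast at k2
      rw [add_mul, one_mul, Real.sin_add, k3] at k2
      have : (Real.cos (j * φ) - 1) * Real.sin φ = 0 := by linarith
      have := (mul_eq_zero.mp this).resolve_right hs
      linarith
    obtain ⟨n, hn⟩ := (Real.cos_eq_one_iff _).mp k4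
    have : (j : ℝ) = n * M s t := by
      rw [hφ] at hn
      have hm0 : (M s t : ℝ) ≠ 0 := by linarith
      field_simp at hn
      have := Real.pi_pos.ne'
      linarith
    have h5 : (j : ℤ) = n * M s t := by exact_mod_cast this
    have : ((M s t : ℕ) : ℤ) ∣ j := ⟨n, by rw [h5]; ring⟩
    exact_mod_cast this

lemma simple_inj : Function.Injective M.simple := by
  intro s t h
  by_contra hst
  have h1 : (M.simple s * M.simple t) ^ 1 = 1 := by
    rw [h, pow_one]; exact M.toCoxeterSystem.simple_mul_simple_self t
  have := dvd_of_pow_eq_one M s t 1 h1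
  exact M.off_diagonal s t hst (Nat.dvd_one.mp this)

lemma M_ne_zero [Finite M.Group] (s t : B) : M s t ≠ 0 := by
  intro h
  have h1 := dvd_of_pow_eq_one M s t (orderOf (M.simple s * M.simple t)) (pow_orderOf_eq_one _)
  rw [h, zero_dvd_iff] at h1
  exact (orderOf_pos _).ne' h1

end Geom

end ArtinTits


namespace ArtinTits

section AltProd

lemma altProd_map {G H : Type*} [Monoid G] [Monoid H] (f : G →* H) (a b : G) (n : ℕ) :
    f (altProd a b n) = altProd (f a) (f b) n := by
  induction n generalizing a b with
  | zero => simp [altProd]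
  | succ n ih => simp [altProd, ih]

lemma altProd_mem {G S : Type*} [Monoid G] [SetLike S G] [SubmonoidClass S G] (H : S) {a b : G}
    (ha : a ∈ H) (hb : b ∈ H) (n : ℕ) : altProd a b n ∈ H := by
  induction n generalizing a b with
  | zero => exact one_mem _
  | succ n ih => exact mul_mem ha (ih hb ha)

lemma altProd_invol {G : Type*} [Group G] (a b : G) (ha : a * a = 1) (hb : b * b = 1) (n : ℕ) :
    altProd a b n * (altProd b a n)⁻¹ = (a * b) ^ n := by
  induction n generalizing a b with
  | zero => simp [altProd]
  | succ n ih =>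
    have h := ih b a hb ha
    simp only [altProd, mul_inv_rev]
    have ha' : a⁻¹ = a := inv_eq_of_mul_eq_one_left ha
    have hb' : b⁻¹ = b := inv_eq_of_mul_eq_one_left hb
    calc a * altProd b a n * ((altProd a b n)⁻¹ * b⁻¹)
        = a * (altProd b a n * (altProd a b n)⁻¹) * b⁻¹ := by simp only [mul_assoc]
      _ = a * (b * a) ^ n * b := by rw [h, hb']
      _ = (a * b) ^ (n + 1) := by
        clear ih h
        induction n with
        | zero => simp
        | succ n ihn =>
          rw [pow_succ, pow_succ (a * b), ← ihn]
          simp only [mul_assoc]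

/-- Split an alternating product. -/
lemma altProd_split {G : Type*} [Monoid G] (a b : G) (m k : ℕ) :
    ∃ l, (l = altProd a b k ∨ l = altProd b a k) ∧ altProd a b (m + k) = altProd a b m * l := by
  induction m generalizing a b with
  | zero => exact ⟨_, Or.inl rfl, by simp [altProd]⟩
  | succ m ih =>
    obtain ⟨l, hl, h⟩ := ih b a
    refine ⟨l, hl.symm, ?_⟩
    rw [show m + 1 + k = (m + k) + 1 by ring]
    simp only [altProd, h, mul_assoc]

end AltProd

section Cox

set_option linter.unusedSectionVars false

variable {B : Type*} {M : CoxeterMatrix B}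

/-- The length function. -/
noncomputable def len (w : M.Group) : ℕ := M.toCoxeterSystem.length w

@[simp] lemma len_one : len (1 : M.Group) = 0 := M.toCoxeterSystem.length_one

@[simp] lemma len_inv (w : M.Group) : len w⁻¹ = len w := M.toCoxeterSystem.length_inv w

@[simp] lemma len_simple (s : B) : len (M.simple s) = 1 := M.toCoxeterSystem.length_simple s

lemma len_mul_le (u v : M.Group) : len (u * v) ≤ len u + len v :=
  M.toCoxeterSystem.length_mul_le u v

lemma len_eq_zero {w : M.Group} : len w = 0 ↔ w = 1 := M.toCoxeterSystem.length_eq_zero_iff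

lemma len_eq_one {w : M.Group} : len w = 1 ↔ ∃ s, w = M.simple s :=
  M.toCoxeterSystem.length_eq_one_iff

@[simp] lemma ss (s : B) : M.simple s * M.simple s = 1 :=
  M.toCoxeterSystem.simple_mul_simple_self s

@[simp] lemma ssw (s : B) (w : M.Group) : M.simple s * (M.simple s * w) = w :=
  M.toCoxeterSystem.simple_mul_simple_cancel_left s

@[simp] lemma sinv (s : B) : (M.simple s)⁻¹ = M.simple s :=
  M.toCoxeterSystem.inv_simple s

lemma len_sw (s : B) (w : M.Group) :
    len (M.simple s * w) = len w + 1 ∨ len (M.simple s * w) + 1 = len w :=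
  M.toCoxeterSystem.length_simple_mul w s

lemma len_ws (s : B) (w : M.Group) :
    len (w * M.simple s) = len w + 1 ∨ len (w * M.simple s) + 1 = len w :=
  M.toCoxeterSystem.length_mul_simple w s

lemma exists_desc {w : M.Group} (h : w ≠ 1) : ∃ s, len (M.simple s * w) + 1 = len w := by
  obtain ⟨s, hs⟩ := M.toCoxeterSystem.exists_leftDescent_of_ne_one h
  refine ⟨s, ?_⟩
  have : len (M.simple s * w) < len w := hs
  have := len_sw s w
  omega

lemma len_le_word (ω : List B) : len (M.toCoxeterSystem.wordProd ω) ≤ ω.length :=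
  M.toCoxeterSystem.length_wordProd_le ω

lemma exists_word (w : M.Group) : ∃ ω : List B, M.toCoxeterSystem.wordProd ω = w ∧
    ω.length = len w := by
  obtain ⟨ω, h, h'⟩ := M.toCoxeterSystem.exists_isReduced w
  refine ⟨ω, h'.symm, ?_⟩
  rw [h']; exact h.symm

lemma exch (s : B) (u v : M.Group) (hR : len (u * v) = len u + len v)
    (h1 : len (M.simple s * u) = len u + 1) (h2 : len (M.simple s * (u * v)) < len (u * v)) :
    ∃ v', M.simple s * (u * v) = u * v' ∧ len v' + 1 = len v := by
  obtain ⟨ωu, hu, hu'⟩ := exists_word u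
  obtain ⟨ωv, hv, hv'⟩ := exists_word v
  have hw : M.toCoxeterSystem.wordProd (ωu ++ ωv) = u * v := by
    rw [M.toCoxeterSystem.wordProd_append, hu, hv]
  obtain ⟨l₁, j, l₂, he, hp⟩ := exchange_left M.toCoxeterSystem (ωu ++ ωv) s
    (by rw [hw]; exact h2)
  rw [hw] at hp
  change M.simple s * (u * v) = _ at hp
  rw [M.toCoxeterSystem.wordProd_append] at hp
  have hdis := len_sw s (u * v)
  rcases List.append_eq_append_iff.mp he with ⟨a, ha, hb⟩ | ⟨a, ha, hb⟩
  · refine ⟨M.toCoxeterSystem.wordProd (a ++ l₂), ?_, ?_⟩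
    · rw [hp, ha, M.toCoxeterSystem.wordProd_append, M.toCoxeterSystem.wordProd_append, hu,
        mul_assoc]
    · have e1 := len_le_word (M := M) (a ++ l₂)
      have e2 : ωv.length = (a ++ l₂).length + 1 := by
        rw [hb]; simp [add_assoc]
      have e3 : M.simple s * (u * v) = u * M.toCoxeterSystem.wordProd (a ++ l₂) := by
        rw [hp, ha, M.toCoxeterSystem.wordProd_append, M.toCoxeterSystem.wordProd_append, hu,
          mul_assoc]
      have e4 := len_mul_le u (M.toCoxeterSystem.wordProd (a ++ l₂))
      rw [← e3] at e4
      omega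
  · cases a with
    | nil =>
      simp only [List.nil_append, List.append_nil] at ha hb
      refine ⟨M.toCoxeterSystem.wordProd l₂, ?_, ?_⟩
      · rw [hp, ← ha, hu]
      · have e1 := len_le_word (M := M) l₂
        have e3 : M.simple s * (u * v) = u * M.toCoxeterSystem.wordProd l₂ := by
          rw [hp, ← ha, hu]
        have e4 := len_mul_le u (M.toCoxeterSystem.wordProd l₂)
        rw [← e3] at e4
        have e2 : ωv.length = l₂.length + 1 := by rw [← hb]; simp
        omega
    | cons j' a =>
      exfalso
      simp only [List.cons_append, List.cons.injEq] at hb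
      obtain ⟨rfl, rfl⟩ := hb
      have e3 : M.simple s * u = M.toCoxeterSystem.wordProd (l₁ ++ a) := by
        rw [M.toCoxeterSystem.wordProd_append, hv, ← mul_assoc, ← mul_assoc] at hp
        rw [M.toCoxeterSystem.wordProd_append]
        exact mul_right_cancel hp
      have e1 := len_le_word (M := M) (l₁ ++ a)
      rw [← e3] at e1
      have e2 : ωu.length = (l₁ ++ a).length + 1 := by rw [ha]; simp [add_assoc]
      omega

/-- Every element of `W_X` has a reduced word in `X`. -/
lemma WP_word {X : Set B} {w : M.Group} (h : w ∈ WP M X) :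
    ∃ ω : List B, (∀ s ∈ ω, s ∈ X) ∧ M.toCoxeterSystem.wordProd ω = w ∧ ω.length = len w := by
  have step : ∀ s ∈ X, ∀ y : M.Group,
      (∃ ω : List B, (∀ s ∈ ω, s ∈ X) ∧ M.toCoxeterSystem.wordProd ω = y ∧ ω.length = len y) →
      ∃ ω : List B, (∀ s ∈ ω, s ∈ X) ∧ M.toCoxeterSystem.wordProd ω = M.simple s * y ∧
        ω.length = len (M.simple s * y) := by
    rintro s hs y ⟨ω, h1, h2, h3⟩
    rcases len_sw s y with h | h
    · refine ⟨s :: ω, ?_, ?_, ?_⟩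
      · intro t ht
        rcases List.mem_cons.mp ht with rfl | ht
        · exact hs
        · exact h1 t ht
      · rw [M.toCoxeterSystem.wordProd_cons, h2]; rfl
      · rw [h, List.length_cons, h3]
    · obtain ⟨l₁, j, l₂, he, hp⟩ := exchange_left M.toCoxeterSystem ω s
        (by rw [h2]; change len (M.simple s * y) < len y; omega)
      rw [h2] at hp
      change M.simple s * y = _ at hp
      refine ⟨l₁ ++ l₂, ?_, hp.symm, ?_⟩
      · intro t ht
        apply h1
        rw [he]
        simp only [List.mem_append, List.mem_cons] at ht ⊢
        tauto
      · have : ω.length = (l₁ ++ l₂).length + 1 := by rw [he]; simp [add_assoc]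
        omega
  unfold WP at h
  induction h using Subgroup.closure_induction_left with
  | one => exact ⟨[], by simp, by simp, by simp⟩
  | mul_left x hx y hy ih =>
    obtain ⟨s, hs, rfl⟩ := hx
    exact step s hs y ih
  | inv_mul_cancel x hx y hy ih =>
    obtain ⟨s, hs, rfl⟩ := hx
    rw [sinv]
    exact step s hs y ih

lemma simple_mem_WP {X : Set B} {s : B} (h : s ∈ X) : M.simple s ∈ WP M X :=
  Subgroup.subset_closure ⟨s, h, rfl⟩

lemma word_mem_WP {X : Set B} {ω : List B} (h : ∀ s ∈ ω, s ∈ X) :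
    M.toCoxeterSystem.wordProd ω ∈ WP M X := by
  induction ω with
  | nil => simp [one_mem]
  | cons s ω ih =>
    rw [M.toCoxeterSystem.wordProd_cons]
    exact mul_mem (simple_mem_WP (h s (by simp))) (ih fun t ht => h t (by simp [ht]))

lemma WP_cases {X : Set B} {w : M.Group} (h : w ∈ WP M X) :
    w = 1 ∨ ∃ s ∈ X, ∃ w' ∈ WP M X, w = M.simple s * w' ∧ len w = len w' + 1 := by
  obtain ⟨ω, h1, h2, h3⟩ := WP_word h
  cases ω with
  | nil => left; rw [← h2]; simp
  | cons s ω =>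
    right
    have hs : w = M.simple s * M.toCoxeterSystem.wordProd ω := by
      rw [← h2, M.toCoxeterSystem.wordProd_cons]; rfl
    refine ⟨s, h1 s (by simp), _, word_mem_WP (fun t ht => h1 t (by simp [ht])), hs, ?_⟩
    have e1 := len_le_word (M := M) ω
    have e2 := len_sw s (M.toCoxeterSystem.wordProd ω)
    rw [← hs] at e2
    simp only [List.length_cons] at h3
    omega

lemma WP_ind {X : Set B} {P : M.Group → Prop} (h1 : P 1)
    (hs : ∀ s ∈ X, ∀ w ∈ WP M X, len (M.simple s * w) = len w + 1 → P w → P (M.simple s * w)) :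
    ∀ w ∈ WP M X, P w := by
  suffices ∀ n, ∀ w ∈ WP M X, len w = n → P w from fun w hw => this _ w hw rfl
  intro n
  induction n with
  | zero => intro w _ h; rw [len_eq_zero.mp h]; exact h1
  | succ n ih =>
    intro w hw h
    rcases WP_cases hw with rfl | ⟨s, hsX, w', hw', rfl, hl⟩
    · exact h1
    · exact hs s hsX w' hw' hl (ih w' hw' (by omega))

lemma simple_mem_WP_iff {X : Set B} {t : B} : M.simple t ∈ WP M X ↔ t ∈ X := by
  refine ⟨fun h => ?_, simple_mem_WP⟩
  rcases WP_cases h with h | ⟨s, hs, w', hw', e, hl⟩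
  · have := len_simple (M := M) t
    rw [h] at this; simp at this
  · simp only [len_simple] at hl
    have : w' = 1 := len_eq_zero.mp (by omega)
    rw [this, mul_one] at e
    rw [simple_inj M e]; exact hs

lemma desc_mem {X : Set B} {w : M.Group} (h : w ∈ WP M X) {t : B}
    (ht : len (M.simple t * w) < len w) : t ∈ X := by
  obtain ⟨ω, h1, h2, h3⟩ := WP_word h
  obtain ⟨l₁, j, l₂, he, hp⟩ := exchange_left M.toCoxeterSystem ω t (by rw [h2]; exact ht)
  rw [h2] at hp
  have h5 : M.simple t * w ∈ WP M X := by
    change M.simple t * w = _ at hp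
    rw [hp]
    apply word_mem_WP
    intro t ht
    apply h1
    rw [he]
    simp only [List.mem_append, List.mem_cons] at ht ⊢
    tauto
  have h6 := mul_mem h5 (inv_mem h)
  rw [mul_inv_cancel_right] at h6
  exact simple_mem_WP_iff.mp h6

/-- Prefix order. -/
def pre (u w : M.Group) : Prop := len u + len (u⁻¹ * w) = len w

lemma pre_of_desc {X : Set B} {z : M.Group} (hz : ∀ s ∈ X, len (M.simple s * z) < len z) :
    ∀ w ∈ WP M X, pre w z := by
  apply WP_ind
  · simp [pre]
  · intro s hs w' hw' hl ih
    unfold pre at ih ⊢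
    have hz' := hz s hs
    have e : w' * (w'⁻¹ * z) = z := by simp
    obtain ⟨v', h1, h2⟩ := exch s w' (w'⁻¹ * z) (by rw [e]; omega) hl (by rw [e]; exact hz')
    rw [e] at h1
    have : (M.simple s * w')⁻¹ * z = v' := by
      rw [mul_inv_rev, sinv, mul_assoc, h1]; simp
    rw [this]; omega

lemma pre_refl (u : M.Group) : pre u u := by simp [pre]

lemma one_pre (u : M.Group) : pre 1 u := by simp [pre]

lemma pre_len {u w : M.Group} (h : pre u w) : len u ≤ len w := by unfold pre at h; omega

lemma pre_eq {u w : M.Group} (h : pre u w) (h' : len w ≤ len u) : u = w := by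
  unfold pre at h
  have : len (u⁻¹ * w) = 0 := by omega
  rw [len_eq_zero] at this
  exact inv_mul_eq_one.mp this

lemma pre_antisymm {u w : M.Group} (h : pre u w) (h' : pre w u) : u = w :=
  pre_eq h (pre_len h')

lemma pre_trans {u v w : M.Group} (h : pre u v) (h' : pre v w) : pre u w := by
  unfold pre at *
  have e : u⁻¹ * w = (u⁻¹ * v) * (v⁻¹ * w) := by group
  have e1 := len_mul_le (u⁻¹ * v) (v⁻¹ * w)
  rw [← e] at e1
  have e2 := len_mul_le u (u⁻¹ * w)
  rw [mul_inv_cancel_left] at e2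
  omega

lemma pre_mul {u v : M.Group} : pre u (u * v) ↔ len (u * v) = len u + len v := by
  unfold pre; rw [inv_mul_cancel_left]; exact eq_comm

lemma pre_simple {s : B} {w : M.Group} : pre (M.simple s) w ↔ len (M.simple s * w) < len w := by
  unfold pre
  have := len_sw s w
  simp only [sinv, len_simple]
  omega

lemma exists_longest [Finite M.Group] (X : Set B) :
    ∃ w ∈ WP M X, ∀ u ∈ WP M X, pre u w := by
  obtain ⟨w, hw, hmax⟩ := Set.exists_max_image (WP M X : Set M.Group) len (Set.toFinite _)
    ⟨1, one_mem _⟩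
  refine ⟨w, hw, pre_of_desc ?_⟩
  intro s hs
  have := hmax _ (mul_mem (simple_mem_WP hs) hw)
  have := len_sw s w
  omega

/-- Longest element of `W_X`. -/
noncomputable def wl [Finite M.Group] (X : Set B) : M.Group := (exists_longest (M := M) X).choose

variable [Finite M.Group]

lemma wl_mem (X : Set B) : wl X ∈ WP M X := (exists_longest (M := M) X).choose_spec.1

lemma pre_wl {X : Set B} {u : M.Group} (h : u ∈ WP M X) : pre u (wl X) :=
  (exists_longest (M := M) X).choose_spec.2 u h

lemma wl_inv (X : Set B) : (wl X : M.Group)⁻¹ = wl X :=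
  pre_eq (pre_wl (inv_mem (wl_mem X))) (by simp)

/-- The longest element. -/
noncomputable def w0 : M.Group := wl Set.univ

lemma mem_WP_univ (w : M.Group) : w ∈ WP M Set.univ := by
  obtain ⟨ω, h, -⟩ := exists_word w
  rw [← h]
  exact word_mem_WP (by simp)

lemma pre_w0 (w : M.Group) : pre w w0 := pre_wl (mem_WP_univ w)

lemma red_iff {u v : M.Group} : len (u * v) = len u + len v ↔ pre v (u⁻¹ * w0) := by
  have h1 := pre_w0 u
  have h2 := pre_w0 (u * v)
  unfold pre at *
  rw [mul_inv_rev, mul_assoc] at h2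
  have := len_mul_le u v
  omega

lemma wl_conj {X : Set B} {s : B} (hs : s ∈ X) :
    ∃ s' ∈ X, M.simple s * wl X = wl X * M.simple s' := by
  have h1 := simple_mem_WP (M := M) hs
  have h2 : M.simple s * wl X ∈ WP M X := mul_mem h1 (wl_mem X)
  have h3 := pre_wl h2
  have h4 := pre_wl h1
  unfold pre at h3 h4
  rw [sinv, len_simple] at h4
  have h5 : len ((M.simple s * wl X)⁻¹ * wl X) = 1 := by omega
  rw [mul_inv_rev, sinv, wl_inv] at h5
  obtain ⟨s', hs'⟩ := len_eq_one.mp h5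
  refine ⟨s', ?_, ?_⟩
  · rw [← simple_mem_WP_iff (M := M), ← hs']
    exact mul_mem (mul_mem (wl_mem X) h1) (wl_mem X)
  · rw [← hs', ← mul_assoc, ← mul_assoc]
    nth_rewrite 2 [← wl_inv]
    simp

/-- Elements of rank two parabolics. -/
lemma dihedral (s t : B) : ∀ w ∈ WP M {s, t},
    w = altProd (M.simple s) (M.simple t) (len w) ∨
    w = altProd (M.simple t) (M.simple s) (len w) := by
  apply WP_ind
  · left; simp [altProd]
  · intro a ha w hw hl ih
    rw [hl]
    simp only [altProd]
    rcases Nat.eq_zero_or_pos (len w) with h0 | h0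
    · rw [len_eq_zero.mp h0]
      rcases ha with rfl | rfl <;> simp [altProd]
    obtain ⟨n, hn⟩ : ∃ n, len w = n + 1 := ⟨len w - 1, by omega⟩
    have aux : ∀ x : M.Group, w = M.simple a * x → len x ≤ n → False := by
      intro x hx hxl
      rw [hx, ssw] at hl
      rw [hx] at hn
      omega
    have hal : ∀ (n : ℕ) (s t : B), len (altProd (M.simple s) (M.simple t) n) ≤ n := by
      intro n
      induction n with
      | zero => intro s t; simp [altProd]
      | succ n ihn =>
        intro s t
        have e1 := len_mul_le (M.simple s) (altProd (M.simple t) (M.simple s) n)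
        have e2 := ihn t s
        simp only [altProd]
        simp only [len_simple] at e1
        omega
    rcases ih with ih | ih <;> rcases ha with rfl | rfl
    · rw [hn] at ih
      exact (aux _ ih (hal _ _ _)).elim
    · right; rw [← ih]
    · left; rw [← ih]
    · rw [hn] at ih
      exact (aux _ ih (hal _ _ _)).elim

lemma altProd_eq_simple (s t : B) : altProd (M.simple s) (M.simple t) (M s t) =
    altProd (M.simple t) (M.simple s) (M s t) := by
  rw [← mul_inv_eq_one, altProd_invol _ _ (ss s) (ss t)]
  exact M.toCoxeterSystem.simple_mul_simple_pow s t

lemma len_altProd_le (n : ℕ) (s t : B) : len (altProd (M.simple s) (M.simple t) n) ≤ n := by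
  induction n generalizing s t with
  | zero => simp [altProd]
  | succ n ihn =>
    have e1 := len_mul_le (M.simple s) (altProd (M.simple t) (M.simple s) n)
    have e2 := ihn t s
    simp only [altProd]
    simp only [len_simple] at e1
    omega

lemma len_altProd {s t : B} (hst : s ≠ t) :
    len (altProd (M.simple s) (M.simple t) (M s t)) = M s t := by
  have hW := wl_mem (M := M) {s, t}
  -- both letters start the longest element
  have key : ∀ a b : B, WP M {a, b} = WP M {s, t} → a ≠ b →
      (wl {s, t} : M.Group) = altProd (M.simple a) (M.simple b) (len (wl {s, t} : M.Group)) := by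
    intro a b hab hne
    have haW : M.simple a ∈ WP M {s, t} := by rw [← hab]; exact simple_mem_WP (by simp)
    have h1 := pre_wl haW
    set z : M.Group := wl {s, t}
    have h2 : M.simple a * z ∈ WP M {a, b} := by rw [hab]; exact mul_mem haW hW
    unfold pre at h1
    rw [sinv, len_simple] at h1
    have hz : z = M.simple a * (M.simple a * z) := by simp
    have : len z = len (M.simple a * z) + 1 := by omega
    rw [this]
    rcases dihedral a b _ h2 with h | h
    · rcases Nat.eq_zero_or_pos (len (M.simple a * z)) with h0 | h0
      · rw [h0]
        rw [len_eq_zero] at h0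
        rw [h0] at hz
        simpa [altProd] using hz
      · exfalso
        obtain ⟨n, hn⟩ : ∃ n, len (M.simple a * z) = n + 1 :=
          ⟨len (M.simple a * z) - 1, by omega⟩
        rw [hn] at h
        simp only [altProd] at h
        have h5 := mul_left_cancel h
        have := len_altProd_le (M := M) n b a
        rw [← h5] at this
        omega
    · nth_rewrite 1 [hz]
      simp only [altProd]
      rw [← h]
  have k1 := key s t rfl hst
  have k2 := key t s (by rw [Set.pair_comm]) hst.symm
  set z : M.Group := wl {s, t}
  have h3 : (M.simple s * M.simple t) ^ (len z) = 1 := by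
    rw [← altProd_invol _ _ (ss s) (ss t), ← k1, ← k2, mul_inv_cancel]
  have h4 := dvd_of_pow_eq_one M s t _ h3
  have hpos : 0 < len z := by
    have := pre_len (pre_wl (simple_mem_WP (M := M) (X := {s, t}) (s := s) (by simp)))
    rw [len_simple] at this
    exact this
  have h5 := Nat.le_of_dvd hpos h4
  obtain ⟨l, hl, h6⟩ := altProd_split (M.simple s) (M.simple t) (M s t) (len z - M s t)
  rw [show M s t + (len z - M s t) = len z by omega, ← k1] at h6
  have h7 := len_mul_le (altProd (M.simple s) (M.simple t) (M s t)) l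
  rw [← h6] at h7
  have h8 : len (M := M) l ≤ len z - M s t := by
    rcases hl with rfl | rfl <;> exact len_altProd_le _ _ _
  have := len_altProd_le (M := M) (M s t) s t
  omega

lemma altProd_pre {s t : B} {w : M.Group} (hs : pre (M.simple s) w) (ht : pre (M.simple t) w)
    (n : ℕ) : pre (altProd (M.simple s) (M.simple t) n) w := by
  apply pre_of_desc (X := {s, t})
  · rintro a (rfl | rfl)
    · exact pre_simple.mp hs
    · exact pre_simple.mp ht
  · exact altProd_mem _ (simple_mem_WP (by simp)) (simple_mem_WP (by simp)) n

end Cox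

end ArtinTits


namespace ArtinTits

lemma meet_exists_aux {α : Type*} (le cov : α → α → Prop) (rk : α → ℤ)
    (trans : ∀ x y z, le x y → le y z → le x z) (refl : ∀ x, le x x)
    (hrk : ∀ x y, cov x y → rk y = rk x + 1) (hle : ∀ x y, cov x y → le x y)
    (hmono : ∀ x y, le x y → rk x ≤ rk y)
    (hcov : ∀ x p, le x p → x = p ∨ ∃ y, cov x y ∧ le y p)
    (hjoin : ∀ x y₁ y₂ p₀, cov x y₁ → cov x y₂ → le y₁ p₀ → le y₂ p₀ →
      ∃ j, le y₁ j ∧ le y₂ j ∧ ∀ p, le y₁ p → le y₂ p → le j p) :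
    ∀ x p q, le x p → le x q →
      ∃ m, le x m ∧ le m p ∧ le m q ∧ ∀ d, le x d → le d p → le d q → le d m := by
  suffices H : ∀ n : ℕ, ∀ x p q, le x p → le x q → rk p - rk x ≤ n →
      ∃ m, le x m ∧ le m p ∧ le m q ∧ ∀ d, le x d → le d p → le d q → le d m by
    intro x p q h1 h2
    exact H (rk p - rk x).toNat x p q h1 h2 (Int.self_le_toNat _)
  intro n
  induction n with
  | zero =>
    intro x p q h1 h2 h3
    rcases hcov x p h1 with rfl | ⟨y, hy, hy'⟩
    · exact ⟨x, refl x, refl x, h2, fun d _ h _ => h⟩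
    · have := hrk x y hy
      have := hmono _ _ hy'
      push_cast at h3
      omega
  | succ n ih =>
    intro x p q h1 h2 h3
    push_cast at h3
    by_cases hex : ∃ y, cov x y ∧ le y p ∧ le y q
    · obtain ⟨y, hy, hyp, hyq⟩ := hex
      have hry := hrk x y hy
      obtain ⟨m, hm1, hm2, hm3, hm4⟩ := ih y p q hyp hyq (by omega)
      refine ⟨m, trans _ _ _ (hle _ _ hy) hm1, hm2, hm3, ?_⟩
      intro d hd1 hd2 hd3
      rcases hcov x d hd1 with rfl | ⟨y', hy', hy'd⟩
      · exact trans _ _ _ (hle _ _ hy) hm1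
      have hy'p := trans _ _ _ hy'd hd2
      have hy'q := trans _ _ _ hy'd hd3
      have hry' := hrk x y' hy'
      obtain ⟨m', hm1', hm2', hm3', hm4'⟩ := ih y' p q hy'p hy'q (by omega)
      obtain ⟨j, hj1, hj2, hj⟩ := hjoin x y y' p hy hy' hyp hy'p
      have hjp := hj p hyp hy'p
      have hjq := hj q hyq hy'q
      have hrj := hmono _ _ hj1
      obtain ⟨m'', hm1'', hm2'', hm3'', hm4''⟩ := ih j p q hjp hjq (by omega)
      have a1 : le d m' := hm4' d hy'd hd2 hd3
      have a2 : le j m' := hm4' j hj2 hjp hjq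
      have a3 : le m' m'' := hm4'' m' a2 hm2' hm3'
      have a4 : le m'' m := hm4 m'' (trans _ _ _ hj1 hm1'') hm2'' hm3''
      exact trans _ _ _ a1 (trans _ _ _ a3 a4)
    · refine ⟨x, refl x, h1, h2, ?_⟩
      intro d hd1 hd2 hd3
      rcases hcov x d hd1 with rfl | ⟨y', hy', hy'd⟩
      · exact refl _
      · exact absurd ⟨y', hy', trans _ _ _ hy'd hd2, trans _ _ _ hy'd hd3⟩ hex

section Cox2

set_option linter.unusedSectionVars false

variable {B : Type*} {M : CoxeterMatrix B} [Finite M.Group]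

lemma pre_translate {x p a : M.Group} (h : pre x p) :
    pre a (x⁻¹ * p) ↔ pre x (x * a) ∧ pre (x * a) p := by
  unfold pre at *
  have e1 : x⁻¹ * (x * a) = a := by group
  have e2 : (x * a)⁻¹ * p = a⁻¹ * (x⁻¹ * p) := by group
  rw [e1, e2]
  have h1 := len_mul_le x a
  have h2 := len_mul_le (x * a) (a⁻¹ * (x⁻¹ * p))
  have e3 : x * a * (a⁻¹ * (x⁻¹ * p)) = p := by group
  rw [e3] at h2
  omega

lemma pre_translate' {x a b : M.Group} (h : pre x (x * b)) (h' : pre a b) :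
    pre (x * a) (x * b) := by
  have := (pre_translate (a := a) h).mp (by simpa using h')
  exact this.2

lemma simple_pre_altProd {s t : B} (hst : s ≠ t) :
    pre (M.simple s) (altProd (M.simple s) (M.simple t) (M s t)) := by
  rw [pre_simple, len_altProd hst]
  obtain ⟨n, hn⟩ : ∃ n, M s t = n + 1 := ⟨M s t - 1, by have := M_ne_zero M s t; omega⟩
  rw [hn]
  simp only [altProd]
  rw [ssw]
  have := len_altProd_le (M := M) n t s
  omega

lemma simple_pre_altProd' {s t : B} (hst : s ≠ t) :
    pre (M.simple t) (altProd (M.simple s) (M.simple t) (M s t)) := by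
  rw [altProd_eq_simple, M.symmetric s t]
  exact simple_pre_altProd hst.symm

lemma exists_meet (p q : M.Group) : ∃ m, pre m p ∧ pre m q ∧ ∀ d, pre d p → pre d q → pre d m := by
  obtain ⟨m, -, h1, h2, h3⟩ := meet_exists_aux (α := M.Group) pre
    (fun x y => ∃ s, y = x * M.simple s ∧ len y = len x + 1) (fun w => (len w : ℤ))
    (fun x y z => pre_trans) pre_refl
    (by rintro x y ⟨s, -, h⟩; simp [h])
    (by
      rintro x y ⟨s, rfl, h⟩
      rw [pre_mul]; simpa using h)
    (fun x y h => by exact_mod_cast pre_len h)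
    (by
      intro x p hxp
      by_cases h : x = p
      · exact Or.inl h
      right
      have hne : x⁻¹ * p ≠ 1 := by rwa [Ne, inv_mul_eq_one]
      obtain ⟨s, hs⟩ := exists_desc hne
      have h1 : pre (M.simple s) (x⁻¹ * p) := by rw [pre_simple]; omega
      obtain ⟨h2, h3⟩ := (pre_translate hxp).mp h1
      refine ⟨_, ⟨s, rfl, ?_⟩, h3⟩
      rw [pre_mul] at h2
      simpa using h2)
    (by
      rintro x y₁ y₂ p₀ ⟨s, rfl, hs⟩ ⟨t, rfl, ht⟩ h1 h2
      by_cases hst : s = t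
      · subst hst
        exact ⟨_, pre_refl _, pre_refl _, fun p h _ => h⟩
      have hxs : pre x (x * M.simple s) := by rw [pre_mul]; simpa using hs
      have hxt : pre x (x * M.simple t) := by rw [pre_mul]; simpa using ht
      have key : ∀ p, pre (x * M.simple s) p → pre (x * M.simple t) p →
          pre x (x * altProd (M.simple s) (M.simple t) (M s t)) ∧
          pre (x * altProd (M.simple s) (M.simple t) (M s t)) p := by
        intro p hs' ht'
        have hxp := pre_trans hxs hs'
        have a1 := (pre_translate hxp).mpr ⟨hxs, hs'⟩
        have a2 := (pre_translate hxp).mpr ⟨hxt, ht'⟩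
        exact (pre_translate hxp).mp (altProd_pre a1 a2 (M s t))
      have hx := (key p₀ h1 h2).1
      exact ⟨_, pre_translate' hx (simple_pre_altProd hst),
        pre_translate' hx (simple_pre_altProd' hst), fun p hp hp' => (key p hp hp').2⟩)
    1 p q (one_pre p) (one_pre q)
  exact ⟨m, h1, h2, fun d => h3 d (one_pre d)⟩

/-- The largest left divisor `v` of `w` such that `u * v` is a reduced product. -/
noncomputable def cc (u w : M.Group) : M.Group := (exists_meet w (u⁻¹ * w0)).choose

lemma cc_pre (u w : M.Group) : pre (cc u w) w := (exists_meet w (u⁻¹ * w0)).choose_spec.1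

lemma cc_red (u w : M.Group) : len (u * cc u w) = len u + len (cc u w) :=
  red_iff.mpr (exists_meet w (u⁻¹ * w0)).choose_spec.2.1

lemma pre_cc {u v w : M.Group} (h : pre v w) (h' : len (u * v) = len u + len v) :
    pre v (cc u w) :=
  (exists_meet w (u⁻¹ * w0)).choose_spec.2.2 v h (red_iff.mp h')

lemma cc_cocycle {u v : M.Group} (h : len (u * v) = len u + len v) (w : M.Group) :
    pre (cc (u * v) w) (cc v w) ∧ cc u (v * cc v w) = v * cc (u * v) w := by
  have h1 := cc_red (u * v) w
  have h2 := len_mul_le u (v * cc (u * v) w)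
  have h3 := len_mul_le v (cc (u * v) w)
  rw [← mul_assoc] at h2
  have h4 : pre (cc (u * v) w) (cc v w) := pre_cc (cc_pre _ _) (by omega)
  refine ⟨h4, ?_⟩
  have hvc : pre v (v * cc v w) := pre_mul.mpr (cc_red v w)
  have hve : pre v (cc u (v * cc v w)) := pre_cc hvc h
  have h5 : pre (v * cc (u * v) w) (cc u (v * cc v w)) := by
    apply pre_cc (pre_translate' hvc h4)
    rw [← mul_assoc]; omega
  obtain ⟨d, hd⟩ : ∃ d, cc u (v * cc v w) = v * d := ⟨v⁻¹ * cc u (v * cc v w), by group⟩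
  have h6 := cc_red u (v * cc v w)
  have h7 := cc_pre u (v * cc v w)
  rw [hd] at hve h5 h6 h7 ⊢
  have h8 : pre d (cc v w) := by
    have := (pre_translate (a := d) hvc).mpr ⟨hve, h7⟩
    simpa using this
  have h9 : pre d (cc (u * v) w) := by
    apply pre_cc (pre_trans h8 (cc_pre v w))
    rw [pre_mul] at hve
    rw [mul_assoc]; omega
  apply pre_antisymm _ h5
  apply pre_translate' _ h9
  rw [pre_mul]; omega

lemma cc_one (u : M.Group) : cc u 1 = 1 := by
  have := pre_len (cc_pre u 1)
  rw [len_one] at this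
  exact len_eq_zero.mp (by omega)

lemma cc_one_left (w : M.Group) : cc 1 w = w :=
  pre_antisymm (cc_pre 1 w) (pre_cc (pre_refl w) (by simp))

lemma cc_w0 (w : M.Group) : cc w0 w = 1 := by
  have h1 := cc_red w0 w
  have h2 := pre_len (pre_w0 (w0 * cc w0 w))
  exact len_eq_zero.mp (by omega)

/-- The element `w_Y w_0`. -/
noncomputable def rr (Y : Set B) : M.Group := wl Y * w0

lemma rr_not {Y : Set B} {s : B} (hs : s ∈ Y) : ¬ pre (M.simple s) (rr Y) := by
  have h1 := pre_wl (simple_mem_WP (M := M) hs)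
  have h2 := pre_w0 (wl Y : M.Group)
  have h3 := pre_w0 (wl Y * M.simple s : M.Group)
  rw [pre_simple]
  unfold pre at *
  rw [wl_inv] at h2
  rw [mul_inv_rev, wl_inv, sinv, mul_assoc] at h3
  rw [sinv, len_simple] at h1
  have h4 : len (wl Y * M.simple s) = len (M.simple s * wl Y) := by
    rw [← len_inv, mul_inv_rev, sinv, wl_inv]
  unfold rr
  omega

lemma rr_pre {Y : Set B} {t : B} (ht : t ∉ Y) : pre (M.simple t) (rr Y) := by
  have h2 := pre_w0 (wl Y : M.Group)
  have h3 := pre_w0 (wl Y * M.simple t : M.Group)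
  have h4 : len (wl Y * M.simple t) = len (M.simple t * wl Y) := by
    rw [← len_inv, mul_inv_rev, sinv, wl_inv]
  have h1 : ¬ len (M.simple t * wl Y) < len (wl Y : M.Group) := fun h => ht (desc_mem (wl_mem Y) h)
  rw [pre_simple]
  unfold pre at *
  rw [wl_inv] at h2
  rw [mul_inv_rev, wl_inv, sinv, mul_assoc] at h3
  have := len_sw t (wl Y : M.Group)
  unfold rr
  omega

lemma rr_conj {Y : Set B} {s : B} (hs : s ∈ Y) :
    ∃ s', M.simple s * rr Y = rr Y * M.simple s' := by
  obtain ⟨s₁, -, h1⟩ := wl_conj (M := M) hs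
  obtain ⟨s₂, -, h2⟩ := wl_conj (M := M) (Set.mem_univ s₁)
  refine ⟨s₂, ?_⟩
  unfold rr w0
  rw [← mul_assoc, h1, mul_assoc, h2, mul_assoc]

end Cox2

end ArtinTits


namespace ArtinTits

section Mon

set_option linter.unusedSectionVars false

variable {B : Type*} (M : CoxeterMatrix B)

/-- Relations of the Artin monoid. -/
def amRel : FreeMonoid B → FreeMonoid B → Prop := fun a b =>
  ∃ s t : B, M s t ≠ 0 ∧ a = altProd (FreeMonoid.of s) (FreeMonoid.of t) (M s t) ∧
    b = altProd (FreeMonoid.of t) (FreeMonoid.of s) (M s t)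

/-- The Artin monoid. -/
abbrev AM := PresentedMonoid (amRel M)

/-- Generators of the Artin monoid. -/
def gen (s : B) : AM M := PresentedMonoid.of (amRel M) s

lemma gen_braid (s t : B) (h : M s t ≠ 0) :
    altProd (gen M s) (gen M t) (M s t) = altProd (gen M t) (gen M s) (M s t) := by
  have := PresentedMonoid.mk_eq_mk_of_rel (rels := amRel M) ⟨s, t, h, rfl, rfl⟩
  rw [altProd_map, altProd_map] at this
  exact this

variable {M} in
def amLift {N : Type*} [Monoid N] (f : B → N) (h : ∀ s t, M s t ≠ 0 →
    altProd (f s) (f t) (M s t) = altProd (f t) (f s) (M s t)) : AM M →* N :=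
  PresentedMonoid.lift f (by
    rintro a b ⟨s, t, h0, rfl, rfl⟩
    rw [altProd_map, altProd_map]
    exact h s t h0)

variable {M} in
lemma amLift_gen {N : Type*} [Monoid N] (f : B → N) (h : ∀ s t, M s t ≠ 0 →
    altProd (f s) (f t) (M s t) = altProd (f t) (f s) (M s t)) (s : B) :
    amLift f h (gen M s) = f s := rfl

variable {M} in
lemma am_ind {P : AM M → Prop} (h1 : P 1) (hs : ∀ s p, P p → P (gen M s * p)) : ∀ p, P p := by
  intro p
  induction p using PresentedMonoid.inductionOn with
  | h a =>
    induction a using FreeMonoid.inductionOn' with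
    | one => rw [map_one]; exact h1
    | of_mul s a ih => rw [map_mul]; exact hs s _ ih

/-- Product of a word in the monoid. -/
def mon (ω : List B) : AM M := (ω.map (gen M)).prod

lemma mon_cons (s : B) (ω : List B) : mon M (s :: ω) = gen M s * mon M ω := by simp [mon]

lemma mon_append (l l' : List B) : mon M (l ++ l') = mon M l * mon M l' := by simp [mon]

/-- Alternating word. -/
def altW (s t : B) : ℕ → List B
  | 0 => []
  | n + 1 => s :: altW t s n

lemma altW_length (s t : B) (n : ℕ) : (altW s t n).length = n := by
  induction n generalizing s t with
  | zero => rfl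
  | succ n ih => simp [altW, ih]

lemma altW_mon (s t : B) (n : ℕ) : mon M (altW s t n) = altProd (gen M s) (gen M t) n := by
  induction n generalizing s t with
  | zero => rfl
  | succ n ih => rw [altW, mon_cons, ih]; rfl

lemma altW_prod (s t : B) (n : ℕ) : M.toCoxeterSystem.wordProd (altW s t n) =
    altProd (M.simple s) (M.simple t) n := by
  induction n generalizing s t with
  | zero => simp [altW, altProd]
  | succ n ih => rw [altW, M.toCoxeterSystem.wordProd_cons, ih]; rfl

variable [Finite M.Group]

/-- Matsumoto's theorem. -/
lemma matsumoto (n : ℕ) : ∀ ω ω' : List B, ω.length = n → ω'.length = n →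
    len (M.toCoxeterSystem.wordProd ω) = n →
    M.toCoxeterSystem.wordProd ω = M.toCoxeterSystem.wordProd ω' → mon M ω = mon M ω' := by
  induction n with
  | zero =>
    intro ω ω' h h' _ _
    rw [List.length_eq_zero_iff.mp h, List.length_eq_zero_iff.mp h']
  | succ n ih =>
    intro ω ω' h h' hl he
    obtain ⟨s, ω, rfl⟩ := List.exists_cons_of_length_eq_add_one h
    obtain ⟨t, ω', rfl⟩ := List.exists_cons_of_length_eq_add_one h'
    simp only [List.length_cons, add_left_inj] at h h'
    have hl' := hl
    rw [he] at hl'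
    rw [M.toCoxeterSystem.wordProd_cons] at hl hl' he
    rw [M.toCoxeterSystem.wordProd_cons] at he
    change len (M.simple s * _) = _ at hl
    change len (M.simple t * _) = _ at hl'
    change M.simple s * _ = M.simple t * _ at he
    set w := M.simple s * M.toCoxeterSystem.wordProd ω with hw
    have hωl := len_le_word (M := M) ω
    have hωl' := len_le_word (M := M) ω'
    have e1 := len_sw s (M.toCoxeterSystem.wordProd ω)
    have e2 := len_sw t (M.toCoxeterSystem.wordProd ω')
    rw [← hw] at e1
    rw [← he] at e2 hl'
    have hs : pre (M.simple s) w := by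
      rw [pre_simple, show M.simple s * w = _ from by rw [hw, ssw]]; omega
    have ht : pre (M.simple t) w := by
      rw [pre_simple, show M.simple t * w = _ from by rw [he, ssw]]; omega
    rw [mon_cons, mon_cons]
    by_cases hst : s = t
    · subst hst
      rw [ih ω ω' h h' (by omega) (mul_left_cancel he)]
    have ha := altProd_pre hs ht (M s t)
    unfold pre at ha
    rw [len_altProd hst] at ha
    obtain ⟨ω₂, h2, h2'⟩ := exists_word ((altProd (M.simple s) (M.simple t) (M s t))⁻¹ * w)
    obtain ⟨k, hk⟩ : ∃ n, M s t = n + 1 := ⟨M s t - 1, by have := M_ne_zero M s t; omega⟩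
    rw [← h2', hl] at ha
    have hbr := altProd_eq_simple (M := M) s t
    have f1 : mon M ω = mon M (altW t s k ++ ω₂) := by
      apply ih _ _ h (by rw [List.length_append, altW_length]; omega) (by omega)
      rw [M.toCoxeterSystem.wordProd_append, altW_prod, h2]
      apply mul_left_cancel (a := M.simple s)
      rw [← hw, hk]
      simp only [altProd]
      group
    have f2 : mon M ω' = mon M (altW s t k ++ ω₂) := by
      apply ih _ _ h' (by rw [List.length_append, altW_length]; omega) (by omega)
      rw [M.toCoxeterSystem.wordProd_append, altW_prod, h2]
      apply mul_left_cancel (a := M.simple t)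
      rw [← he, hbr, hk]
      simp only [altProd]
      group
    rw [f1, f2, mon_append, mon_append, altW_mon, altW_mon, ← mul_assoc, ← mul_assoc]
    have f3 := gen_braid M s t (M_ne_zero M s t)
    rw [hk] at f3
    simp only [altProd] at f3
    rw [f3]

variable {M}

/-- The lift of an element of `W` to the monoid. -/
noncomputable def brk (w : M.Group) : AM M := mon M (exists_word w).choose

lemma brk_eq (ω : List B) (h : len (M.toCoxeterSystem.wordProd ω) = ω.length) :
    brk (M.toCoxeterSystem.wordProd ω) = mon M ω := by
  have hs := (exists_word (M.toCoxeterSystem.wordProd ω)).choose_spec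
  apply matsumoto M ω.length _ _ (by rw [hs.2, h]) rfl
  · rw [hs.1, h]
  · rw [hs.1]

lemma brk_mul {u v : M.Group} (h : len (u * v) = len u + len v) :
    brk (u * v) = brk u * brk v := by
  obtain ⟨ωu, hu, hu'⟩ := exists_word u
  obtain ⟨ωv, hv, hv'⟩ := exists_word v
  have e : M.toCoxeterSystem.wordProd (ωu ++ ωv) = u * v := by
    rw [M.toCoxeterSystem.wordProd_append, hu, hv]
  rw [← e, brk_eq, mon_append, ← brk_eq, ← brk_eq, hu, hv]
  · rw [hv, hv']
  · rw [hu, hu']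
  · rw [e, h, List.length_append, hu', hv']

lemma brk_one : brk (1 : M.Group) = 1 := by
  have := brk_eq (M := M) [] (by simp)
  simpa [mon] using this

lemma brk_simple (s : B) : brk (M.simple s) = gen M s := by
  have := brk_eq (M := M) [s] (by
    simp only [M.toCoxeterSystem.wordProd_singleton, List.length_singleton]
    exact len_simple s)
  rw [M.toCoxeterSystem.wordProd_singleton] at this
  simpa [mon] using this

lemma brk_pre {u w : M.Group} (h : pre u w) : brk u * brk (u⁻¹ * w) = brk w := by
  rw [← brk_mul, mul_inv_cancel_left]
  rw [mul_inv_cancel_left]; exact h.symm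

lemma brk_desc {s : B} {w : M.Group} (h : pre (M.simple s) w) :
    gen M s * brk (M.simple s * w) = brk w := by
  have := brk_pre h
  rwa [brk_simple, sinv] at this

/-- The action on pairs. -/
noncomputable def Hw (u : M.Group) : Function.End (M.Group × AM M) :=
  fun p => (u * cc u p.1, brk ((cc u p.1)⁻¹ * p.1) * p.2)

lemma Hw_mul {u v : M.Group} (h : len (u * v) = len u + len v) : Hw u * Hw v = Hw (u * v) := by
  funext p
  obtain ⟨w, x⟩ := p
  rw [endmul]
  obtain ⟨h1, h2⟩ := cc_cocycle h w
  simp only [Hw]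
  rw [h2]
  refine Prod.ext (mul_assoc _ _ _).symm ?_
  simp only
  rw [← mul_assoc]
  congr 1
  have h3 := cc_pre v w
  rw [← brk_mul]
  · congr 1; group
  · have e : (v * cc (u * v) w)⁻¹ * (v * cc v w) = (cc (u * v) w)⁻¹ * cc v w := by group
    have e' : (cc (u * v) w)⁻¹ * cc v w * ((cc v w)⁻¹ * w) = (cc (u * v) w)⁻¹ * w := by group
    have h4 := pre_trans h1 h3
    rw [e, e']
    unfold pre at *
    omega

lemma Hw_one : Hw (1 : M.Group) = 1 := by
  funext p
  simp only [Hw, cc_one_left, inv_mul_cancel, brk_one, one_mul]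
  rfl

lemma len_altProd_lt {s t : B} (hst : s ≠ t) (n : ℕ) (hn : n ≤ M s t) :
    len (altProd (M.simple s) (M.simple t) n) = n := by
  obtain ⟨l, hl, h⟩ := altProd_split (M.simple s) (M.simple t) n (M s t - n)
  rw [show n + (M s t - n) = M s t by omega] at h
  have h1 := len_mul_le (altProd (M.simple s) (M.simple t) n) l
  rw [← h, len_altProd hst] at h1
  have h8 : len (M := M) l ≤ M s t - n := by
    rcases hl with rfl | rfl <;> exact len_altProd_le (M := M) _ _ _
  have := len_altProd_le (M := M) n s t
  omega

lemma Hw_altProd {s t : B} (hst : s ≠ t) (n : ℕ) (hn : n ≤ M s t) :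
    altProd (Hw (M.simple s)) (Hw (M.simple t)) n = Hw (altProd (M.simple s) (M.simple t) n) := by
  induction n generalizing s t with
  | zero => simp [altProd, Hw_one]
  | succ n ih =>
    have e := ih hst.symm (by rw [M.symmetric]; omega)
    simp only [altProd]
    rw [e, Hw_mul]
    have h1 := len_altProd_lt hst (n + 1) hn
    have h2 := len_altProd_lt hst.symm n (by rw [M.symmetric]; omega)
    simp only [altProd] at h1
    rw [h1, h2, len_simple, add_comm]

/-- The action of the monoid on pairs. -/
noncomputable def act : AM M →* Function.End (M.Group × AM M) :=
  amLift (fun s => Hw (M.simple s)) (by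
    intro s t _
    by_cases hst : s = t
    · subst hst; rfl
    rw [Hw_altProd hst _ le_rfl, Hw_altProd (Ne.symm hst) _ (by rw [M.symmetric]),
      altProd_eq_simple])

lemma act_gen (s : B) : act (gen M s) = Hw (M.simple s) := rfl

lemma act_brk (w : M.Group) : act (brk w) = Hw w := by
  refine WP_ind (X := Set.univ) (P := fun w => act (brk w) = Hw w) ?_ ?_ w (mem_WP_univ w)
  · rw [brk_one, Hw_one, map_one]
  · intro s _ w _ h ih
    have h' : len (M.simple s * w) = len (M.simple s) + len w := by rw [len_simple, h, add_comm]
    rw [brk_mul h', map_mul, ih, brk_simple, act_gen, Hw_mul h']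

lemma Hw_val (u : M.Group) (p : M.Group × AM M) :
    brk (Hw u p).1 * (Hw u p).2 = brk u * (brk p.1 * p.2) := by
  simp only [Hw]
  rw [brk_mul (cc_red u p.1), mul_assoc, ← mul_assoc (brk (cc u p.1)), brk_pre (cc_pre u p.1)]

lemma act_val (q : AM M) (p : M.Group × AM M) :
    brk (act q p).1 * (act q p).2 = q * (brk p.1 * p.2) := by
  induction q using am_ind with
  | h1 => rw [map_one, one_mul]; rfl
  | hs s q ih => rw [map_mul, endmul, act_gen, Hw_val, ih, brk_simple, mul_assoc]

/-- The maximal simple left divisor. -/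
noncomputable def alp (q : AM M) : M.Group := (act q (1, 1)).1

noncomputable def omg (q : AM M) : AM M := (act q (1, 1)).2

lemma alp_omg (q : AM M) : brk (alp q) * omg q = q := by
  have := act_val q (1, 1)
  simp only [brk_one, mul_one] at this
  exact this

lemma alp_brk (w : M.Group) : alp (brk w) = w := by
  unfold alp
  rw [act_brk]
  simp [Hw, cc_one]

lemma alp_mul (w : M.Group) (q : AM M) : pre w (alp (brk w * q)) := by
  unfold alp
  rw [map_mul, endmul, act_brk]
  simp only [Hw]
  rw [pre_mul]
  exact cc_red _ _

lemma brk_dvd_iff {u w : M.Group} : (∃ q, brk w = brk u * q) ↔ pre u w := by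
  constructor
  · rintro ⟨q, hq⟩
    have := alp_mul u q
    rwa [← hq, alp_brk] at this
  · intro h; exact ⟨_, (brk_pre h).symm⟩

lemma brk_inj {u w : M.Group} (h : brk u = brk w) : u = w := by
  rw [← alp_brk u, h, alp_brk]

lemma delta_cancel {p q : AM M} (h : brk (w0 : M.Group) * p = brk w0 * q) : p = q := by
  have key : ∀ p : AM M, act (brk w0 * p) (1, 1) = (w0, p) := by
    intro p
    rw [map_mul, endmul, act_brk]
    simp only [Hw]
    rw [cc_w0]
    have := alp_omg p
    unfold alp omg at this
    simp [this]
  have h1 := key p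
  rw [h, key q] at h1
  exact (congrArg Prod.snd h1).symm

lemma pre_w0_s (s : B) : brk (w0 * M.simple s) * gen M s = brk (w0 : M.Group) := by
  rw [← brk_simple, ← brk_mul, mul_assoc, ss, mul_one]
  rw [mul_assoc, ss, mul_one, len_simple]
  have h1 := pre_w0 (w0 * M.simple s : M.Group)
  have h2 := len_ws s (w0 : M.Group)
  unfold pre at h1
  omega

lemma gen_cancel {s : B} {p q : AM M} (h : gen M s * p = gen M s * q) : p = q := by
  apply delta_cancel
  rw [← pre_w0_s s, mul_assoc, h, mul_assoc]

lemma am_cancel {a p q : AM M} (h : a * p = a * q) : p = q := by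
  induction a using am_ind with
  | h1 => simpa using h
  | hs s a ih =>
    rw [mul_assoc, mul_assoc] at h
    exact ih (gen_cancel h)

lemma delta_conj {X : Set B} {s : B} (hs : s ∈ X) : ∃ s' ∈ X,
    gen M s * brk (wl X : M.Group) = brk (wl X : M.Group) * gen M s' ∧
    gen M s' * brk (wl X : M.Group) = brk (wl X : M.Group) * gen M s := by
  obtain ⟨s', hs', h⟩ := wl_conj (M := M) hs
  have key : ∀ s s' : B, s ∈ X → M.simple s * wl X = wl X * M.simple s' →
      gen M s * brk (wl X : M.Group) = brk (wl X : M.Group) * gen M s' := by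
    intro s s' hs h
    have h1 := pre_wl (simple_mem_WP (M := M) hs)
    have h2 := brk_desc h1
    have h3 : brk (M.simple s * wl X) * gen M s' = brk (wl X : M.Group) := by
      rw [← brk_simple s', ← brk_mul, h, mul_assoc, ss, mul_one]
      rw [h, mul_assoc, ss, mul_one, ← h, len_simple]
      unfold pre at h1
      rw [sinv, len_simple] at h1
      omega
    nth_rewrite 1 [← h3]
    rw [← mul_assoc, h2]
  refine ⟨s', hs', key s s' hs h, key s' s hs' ?_⟩
  have := congrArg (fun x => x⁻¹) h
  simp only [mul_inv_rev, sinv, wl_inv] at this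
  exact this.symm

/-- The central element. -/
noncomputable def zz : AM M := brk w0 * brk w0

lemma zz_central (p : AM M) : p * zz = zz * p := by
  induction p using am_ind with
  | h1 => simp
  | hs s p ih =>
    obtain ⟨s', -, h1, h2⟩ := delta_conj (M := M) (Set.mem_univ s)
    have : gen M s * zz = zz * gen M s := by
      unfold zz w0
      rw [← mul_assoc, h1, mul_assoc, h2, mul_assoc]
    rw [mul_assoc, ih, ← mul_assoc, this, mul_assoc]

lemma zz_right (s : B) : ∃ y : AM M, zz = gen M s * y := by
  have := brk_desc (pre_w0 (M.simple s))
  exact ⟨brk (M.simple s * w0) * brk w0, by rw [← mul_assoc, this]; rfl⟩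

lemma zz_left (s : B) : ∃ y : AM M, zz = y * gen M s := by
  exact ⟨brk w0 * brk (w0 * M.simple s), by rw [mul_assoc, pre_w0_s]; rfl⟩

end Mon

end ArtinTits


namespace ArtinTits

section Emb

set_option linter.unusedSectionVars false

variable {B : Type*} {M : CoxeterMatrix B}

lemma σ_braid (s t : B) (h : M s t ≠ 0) :
    altProd (σ M s) (σ M t) (M s t) = altProd (σ M t) (σ M s) (M s t) := by
  rw [← mul_inv_eq_one]
  have h1 : altProd (FreeGroup.of s) (FreeGroup.of t) (M s t) *
        (altProd (FreeGroup.of t) (FreeGroup.of s) (M s t))⁻¹ ∈ artinRelationsSet M :=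
    ⟨s, t, h, rfl⟩
  have h2 := PresentedGroup.one_of_mem h1
  rw [map_mul, map_inv, altProd_map, altProd_map] at h2
  exact h2

/-- Universal property of the Artin group. -/
def agLift {N : Type*} [Group N] (f : B → N) (h : ∀ s t, M s t ≠ 0 →
    altProd (f s) (f t) (M s t) = altProd (f t) (f s) (M s t)) : ArtinGroup M →* N :=
  PresentedGroup.toGroup (f := f) (by
    rintro r ⟨s, t, h0, rfl⟩
    rw [map_mul, map_inv, altProd_map, altProd_map, mul_inv_eq_one]
    simpa using h s t h0)

lemma agLift_σ {N : Type*} [Group N] (f : B → N) (h : ∀ s t, M s t ≠ 0 →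
    altProd (f s) (f t) (M s t) = altProd (f t) (f s) (M s t)) (s : B) :
    agLift f h (σ M s) = f s := PresentedGroup.toGroup.of _

lemma ag_closure : Subgroup.closure (Set.range (σ M)) = ⊤ :=
  PresentedGroup.closure_range_of _

/-- The natural map from the monoid to the group. -/
def thet : AM M →* ArtinGroup M := amLift (σ M) σ_braid

lemma thet_gen (s : B) : thet (gen M s) = σ M s := rfl

variable [Finite M.Group]

lemma zz_pow_central (p : AM M) (n : ℕ) : p * zz ^ n = zz ^ n * p :=
  ((show Commute p zz from zz_central p).pow_right n)

noncomputable instance zzOre : OreLocalization.OreSet (Submonoid.powers (zz : AM M)) where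
  ore_right_cancel := by
    rintro r₁ r₂ ⟨s, n, rfl⟩ h
    refine ⟨⟨zz ^ n, n, rfl⟩, ?_⟩
    simp only [zz_pow_central] at h
    exact h
  oreNum := fun r _ => r
  oreDenom := fun _ s => s
  ore_eq := by
    rintro r ⟨s, n, rfl⟩
    exact (zz_pow_central r n).symm

/-- The localized monoid. -/
abbrev LocM (M : CoxeterMatrix B) [Finite M.Group] : Type _ :=
  OreLocalization (Submonoid.powers (zz : AM M)) (AM M)

noncomputable def locHom : AM M →* LocM M := OreLocalization.numeratorHom

lemma locHom_inj : Function.Injective (locHom (M := M)) := by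
  intro a b h
  unfold locHom at h
  rw [OreLocalization.numeratorHom_apply, OreLocalization.numeratorHom_apply,
    OreLocalization.oreDiv_eq_iff] at h
  obtain ⟨u, v, h1, h2⟩ := h
  simp only [OneMemClass.coe_one, mul_one] at h2
  rw [Submonoid.smul_def, smul_eq_mul, smul_eq_mul, ← h2] at h1
  exact (am_cancel h1).symm

lemma locHom_gen_unit (s : B) : IsUnit (locHom (gen M s)) := by
  have hz : IsUnit (locHom (zz : AM M)) :=
    OreLocalization.numerator_isUnit (S := Submonoid.powers (zz : AM M))
      ⟨zz, Submonoid.mem_powers _⟩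
  obtain ⟨y, hy⟩ := zz_right (M := M) s
  obtain ⟨y', hy'⟩ := zz_left (M := M) s
  obtain ⟨u, hu⟩ := hz
  have h1 : locHom (gen M s) * (locHom y * ↑u⁻¹) = 1 := by
    rw [← mul_assoc, ← map_mul, ← hy, ← hu, Units.mul_inv]
  have h2 : (↑u⁻¹ * locHom y') * locHom (gen M s) = 1 := by
    rw [mul_assoc, ← map_mul, ← hy', ← hu, Units.inv_mul]
  have h3 := left_inv_eq_right_inv h2 h1
  exact ⟨⟨_, _, h1, by rw [← h3]; exact h2⟩, rfl⟩

noncomputable def locUnit (s : B) : (LocM M)ˣ := (locHom_gen_unit s).unit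

noncomputable def locGrp : ArtinGroup M →* (LocM M)ˣ := agLift locUnit (by
  intro s t h
  apply Units.ext
  have h1 : ∀ (s t : B) (n : ℕ), ((altProd (locUnit s) (locUnit t) n : (LocM M)ˣ) : LocM M) =
      locHom (altProd (gen M s) (gen M t) n) := by
    intro s t n
    rw [altProd_map]
    have := altProd_map (Units.coeHom (LocM M)) (locUnit s) (locUnit t) n
    simpa [locUnit] using this
  rw [h1, h1, gen_braid M s t h])

lemma locGrp_thet (p : AM M) : (locGrp (thet p) : LocM M) = locHom p := by
  induction p using am_ind with
  | h1 => simp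
  | hs s p ih =>
    rw [map_mul, map_mul, map_mul, Units.val_mul, ih, thet_gen]
    congr 1
    unfold locGrp
    rw [agLift_σ]
    rfl

lemma thet_inj : Function.Injective (thet (M := M)) := by
  intro a b h
  apply locHom_inj
  rw [← locGrp_thet, ← locGrp_thet, h]

end Emb

section Grp

set_option linter.unusedSectionVars false

variable {B : Type*} {M : CoxeterMatrix B}

/-- Positive monoid on a set of generators. -/
def Pp (M : CoxeterMatrix B) (Y : Set B) : Submonoid (ArtinGroup M) := Submonoid.closure (σ M '' Y)

def PP (M : CoxeterMatrix B) : Submonoid (ArtinGroup M) := MonoidHom.mrange thet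

lemma σ_mem_Pp {Y : Set B} {s : B} (h : s ∈ Y) : σ M s ∈ Pp M Y :=
  Submonoid.subset_closure ⟨s, h, rfl⟩

lemma σ_mem_PP (s : B) : σ M s ∈ PP M := ⟨gen M s, rfl⟩

lemma Pp_le (Y : Set B) : Pp M Y ≤ PP M := by
  unfold Pp
  rw [Submonoid.closure_le]
  rintro _ ⟨s, -, rfl⟩
  exact σ_mem_PP s

lemma Pp_AP {Y : Set B} {p : ArtinGroup M} (h : p ∈ Pp M Y) : p ∈ AP M Y := by
  have : Pp M Y ≤ (AP M Y).toSubmonoid := by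
    unfold Pp
    rw [Submonoid.closure_le]
    exact Subgroup.subset_closure
  exact this h

lemma altProd_idem {N : Type*} [CommMonoid N] (a b : N) (ha : a * a = a) (hb : b * b = b) (n : ℕ) :
    altProd a b (n + 2) = a * b := by
  induction n generalizing a b with
  | zero => simp [altProd]
  | succ n ih =>
    rw [show n + 1 + 2 = (n + 2) + 1 by ring]
    rw [altProd, ih b a hb ha, mul_comm b a, ← mul_assoc, ha]

open Classical in
/-- Support indicator. -/
noncomputable def supp (M : CoxeterMatrix B) (Y : Set B) : AM M →* ℕ :=
  amLift (fun s => if s ∈ Y then 1 else 0) (by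
    intro s t h
    by_cases hst : s = t
    · subst hst; rfl
    have h1 := M.off_diagonal s t hst
    obtain ⟨n, hn⟩ : ∃ n, M s t = n + 2 := ⟨M s t - 2, by omega⟩
    rw [hn, altProd_idem, altProd_idem, mul_comm]
    all_goals split_ifs <;> simp)

open Classical in
lemma supp_gen (Y : Set B) (s : B) : supp M Y (gen M s) = if s ∈ Y then 1 else 0 := rfl

lemma thet_mem_Pp {Y : Set B} {p : AM M} (h : supp M Y p = 1) : thet p ∈ Pp M Y := by
  induction p using am_ind with
  | h1 => simp [one_mem]
  | hs s p ih =>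
    rw [map_mul] at h
    replace h := And.intro (Nat.eq_one_of_mul_eq_one_right h) (Nat.eq_one_of_mul_eq_one_left h)
    rw [map_mul, thet_gen]
    refine mul_mem ?_ (ih h.2)
    have h1 := h.1
    rw [supp_gen] at h1
    apply σ_mem_Pp
    by_contra hs
    rw [if_neg hs] at h1
    exact absurd h1 (by norm_num)

lemma exists_supp {Y : Set B} {a : ArtinGroup M} (h : a ∈ Pp M Y) :
    ∃ p, thet p = a ∧ supp M Y p = 1 := by
  unfold Pp at h
  induction h using Submonoid.closure_induction with
  | mem x hx =>
    obtain ⟨s, hs, rfl⟩ := hx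
    exact ⟨gen M s, rfl, by rw [supp_gen, if_pos hs]⟩
  | one => exact ⟨1, by simp, by simp⟩
  | mul x y hx hy ihx ihy =>
    obtain ⟨p, rfl, hp⟩ := ihx
    obtain ⟨q, rfl, hq⟩ := ihy
    exact ⟨p * q, by simp, by rw [map_mul, hp, hq]⟩

/-- The length homomorphism. -/
def lnHom (M : CoxeterMatrix B) : ArtinGroup M →* Multiplicative ℤ :=
  agLift (fun _ => Multiplicative.ofAdd 1) (fun _ _ _ => rfl)

def ln (a : ArtinGroup M) : ℤ := Multiplicative.toAdd (lnHom M a)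

@[simp] lemma ln_one : ln (1 : ArtinGroup M) = 0 := by simp [ln]

@[simp] lemma ln_mul (a b : ArtinGroup M) : ln (a * b) = ln a + ln b := by simp [ln]

@[simp] lemma ln_inv (a : ArtinGroup M) : ln a⁻¹ = - ln a := by simp [ln]

@[simp] lemma ln_σ (s : B) : ln (σ M s) = 1 := by
  unfold ln lnHom; rw [agLift_σ]; rfl

lemma PP_list {a : ArtinGroup M} (h : a ∈ PP M) :
    ∃ l : List B, (l.map (σ M)).prod = a ∧ ln a = l.length := by
  obtain ⟨p, rfl⟩ := h
  induction p using am_ind with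
  | h1 => exact ⟨[], by simp, by simp⟩
  | hs s p ih =>
    obtain ⟨l, h1, h2⟩ := ih
    refine ⟨s :: l, ?_, ?_⟩
    · rw [List.map_cons, List.prod_cons, h1, map_mul, thet_gen]
    · rw [map_mul, ln_mul, h2, thet_gen, ln_σ, List.length_cons]; push_cast; ring

lemma Pp_list {Y : Set B} {a : ArtinGroup M} (h : a ∈ Pp M Y) :
    ∃ l : List B, (∀ s ∈ l, s ∈ Y) ∧ (l.map (σ M)).prod = a := by
  unfold Pp at h
  induction h using Submonoid.closure_induction with
  | mem x hx =>
    obtain ⟨s, hs, rfl⟩ := hx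
    exact ⟨[s], by simpa using hs, by simp⟩
  | one => exact ⟨[], by simp, by simp⟩
  | mul x y hx hy ihx ihy =>
    obtain ⟨p, h1, rfl⟩ := ihx
    obtain ⟨q, h2, rfl⟩ := ihy
    refine ⟨p ++ q, ?_, by simp⟩
    intro s hs
    rcases List.mem_append.mp hs with hs | hs
    · exact h1 s hs
    · exact h2 s hs

lemma list_Pp {Y : Set B} {l : List B} (h : ∀ s ∈ l, s ∈ Y) : (l.map (σ M)).prod ∈ Pp M Y := by
  apply list_prod_mem
  intro x hx
  obtain ⟨s, hs, rfl⟩ := List.mem_map.mp hx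
  exact σ_mem_Pp (h s hs)

lemma ln_nonneg {a : ArtinGroup M} (h : a ∈ PP M) : 0 ≤ ln a := by
  obtain ⟨l, -, h⟩ := PP_list h; omega

lemma ln_eq_zero {a : ArtinGroup M} (h : a ∈ PP M) (h0 : ln a = 0) : a = 1 := by
  obtain ⟨l, h1, h2⟩ := PP_list h
  have : l = [] := List.length_eq_zero_iff.mp (by omega)
  rw [← h1, this]; simp

lemma PP_finite [Finite B] (n : ℤ) : {a : ArtinGroup M | a ∈ PP M ∧ ln a ≤ n}.Finite := by
  refine ((List.finite_length_le B n.toNat).image (fun l => (l.map (σ M)).prod)).subset ?_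
  rintro a ⟨h, hn⟩
  obtain ⟨l, h1, h2⟩ := PP_list h
  exact ⟨l, by simp only [Set.mem_ofPred_eq]; omega, h1⟩

/-- Left divisibility. -/
def dv (a b : ArtinGroup M) : Prop := a⁻¹ * b ∈ PP M

lemma dv_refl (a : ArtinGroup M) : dv a a := by simp [dv, one_mem]

lemma dv_trans {a b c : ArtinGroup M} (h : dv a b) (h' : dv b c) : dv a c := by
  unfold dv at *
  have := mul_mem h h'
  rwa [show a⁻¹ * b * (b⁻¹ * c) = a⁻¹ * c by group] at this

lemma dv_ln {a b : ArtinGroup M} (h : dv a b) : ln a ≤ ln b := by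
  have := ln_nonneg h
  simp at this; linarith

lemma dv_eq {a b : ArtinGroup M} (h : dv a b) (h' : ln b ≤ ln a) : a = b := by
  have h1 := ln_nonneg h
  have := ln_eq_zero h (by simp at h1 ⊢; linarith)
  exact inv_mul_eq_one.mp this

lemma dv_antisymm {a b : ArtinGroup M} (h : dv a b) (h' : dv b a) : a = b :=
  dv_eq h (dv_ln h')

lemma dv_mul_left (g : ArtinGroup M) {a b : ArtinGroup M} : dv (g * a) (g * b) ↔ dv a b := by
  unfold dv
  rw [show (g * a)⁻¹ * (g * b) = a⁻¹ * b by group]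

lemma dv_mul {a p : ArtinGroup M} (h : p ∈ PP M) : dv a (a * p) := by
  unfold dv; rwa [inv_mul_cancel_left]

lemma one_dv {a : ArtinGroup M} : dv 1 a ↔ a ∈ PP M := by simp [dv]

variable [Finite M.Group]

lemma Pp_of_mul {Y : Set B} {x y : ArtinGroup M} (hx : x ∈ PP M) (hy : y ∈ PP M)
    (h : x * y ∈ Pp M Y) : x ∈ Pp M Y ∧ y ∈ Pp M Y := by
  obtain ⟨p, rfl⟩ := hx
  obtain ⟨q, rfl⟩ := hy
  obtain ⟨r, hr, hr'⟩ := exists_supp h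
  rw [← map_mul] at hr
  rw [thet_inj hr, map_mul] at hr'
  replace hr' := And.intro (Nat.eq_one_of_mul_eq_one_right hr') (Nat.eq_one_of_mul_eq_one_left hr')
  exact ⟨thet_mem_Pp hr'.1, thet_mem_Pp hr'.2⟩

lemma σ_mem_Pp_iff {Y : Set B} {s : B} : σ M s ∈ Pp M Y ↔ s ∈ Y := by
  refine ⟨fun h => ?_, σ_mem_Pp⟩
  obtain ⟨r, hr, hr'⟩ := exists_supp h
  rw [← thet_gen] at hr
  rw [thet_inj hr, supp_gen] at hr'
  by_contra hs
  rw [if_neg hs] at hr'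
  exact absurd hr' (by norm_num)

/-- Simple elements. -/
noncomputable def sim (w : M.Group) : ArtinGroup M := thet (brk w)

lemma sim_mul {u v : M.Group} (h : len (u * v) = len u + len v) : sim (u * v) = sim u * sim v := by
  unfold sim; rw [brk_mul h, map_mul]

lemma sim_simple (s : B) : sim (M.simple s) = σ M s := by
  unfold sim; rw [brk_simple, thet_gen]

@[simp] lemma sim_one : sim (1 : M.Group) = 1 := by
  unfold sim; rw [brk_one, map_one]

lemma sim_mem (w : M.Group) : sim w ∈ PP M := ⟨_, rfl⟩

lemma sim_inj {u w : M.Group} (h : sim u = sim w) : u = w := brk_inj (thet_inj h)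

lemma ln_sim (w : M.Group) : ln (sim w) = len w := by
  refine WP_ind (X := Set.univ) (P := fun w => ln (sim w) = len w) ?_ ?_ w (mem_WP_univ w)
  · simp
  · intro s _ w _ h ih
    rw [sim_mul (by rw [h, len_simple, add_comm]), ln_mul, ih, sim_simple, ln_σ, h]
    push_cast; ring

lemma sim_mem_AP {X : Set B} {w : M.Group} (h : w ∈ WP M X) : sim w ∈ Pp M X := by
  refine WP_ind (X := X) (P := fun w => sim w ∈ Pp M X) ?_ ?_ w h
  · simp [one_mem]
  · intro s hs w _ h ih
    rw [sim_mul (by rw [h, len_simple, add_comm]), sim_simple]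
    exact mul_mem (σ_mem_Pp hs) ih

lemma sim_dv {u w : M.Group} : dv (sim u) (sim w) ↔ pre u w := by
  rw [← brk_dvd_iff]
  unfold dv sim
  constructor
  · rintro ⟨q, hq⟩
    refine ⟨q, thet_inj ?_⟩
    rw [map_mul, hq, mul_inv_cancel_left]
  · rintro ⟨q, hq⟩
    exact ⟨q, by rw [hq, map_mul, inv_mul_cancel_left]⟩

lemma brk_divisor (x : AM M) : ∀ (y : AM M) (r : M.Group), x * y = brk r →
    ∃ w, pre w r ∧ x = brk w := by
  induction x using am_ind with
  | h1 => intro y r _; exact ⟨1, one_pre r, brk_one.symm⟩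
  | hs s x ih =>
    intro y r h
    rw [mul_assoc, ← brk_simple] at h
    have hs : pre (M.simple s) r := brk_dvd_iff.mp ⟨_, h.symm⟩
    have h2 := brk_desc hs
    rw [← h2, brk_simple] at h
    obtain ⟨w, hw, rfl⟩ := ih y _ (gen_cancel h)
    have h3 := (pre_translate (a := w) hs).mp (by rwa [sinv])
    refine ⟨_, h3.2, ?_⟩
    rw [brk_mul (pre_mul.mp h3.1), brk_simple]

lemma sim_divisor {p : ArtinGroup M} {r : M.Group} (hp : p ∈ PP M) (h : dv p (sim r)) :
    ∃ w, pre w r ∧ p = sim w := by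
  obtain ⟨x, rfl⟩ := hp
  obtain ⟨y, hy⟩ := h
  have : x * y = brk r := by
    apply thet_inj
    rw [map_mul, hy, mul_inv_cancel_left]; rfl
  obtain ⟨w, h1, rfl⟩ := brk_divisor x y r this
  exact ⟨w, h1, rfl⟩

lemma dv_alp {u : M.Group} {q : AM M} (h : dv (sim u) (thet q)) : pre u (alp q) := by
  obtain ⟨y, hy⟩ := h
  have : q = brk u * y := by
    apply thet_inj
    rw [map_mul, hy]; unfold sim; rw [mul_inv_cancel_left]
  rw [this]; exact alp_mul u y

lemma alp_dv (q : AM M) : dv (sim (alp q)) (thet q) :=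
  ⟨omg q, by nth_rewrite 3 [← alp_omg q]; rw [map_mul]; unfold sim; rw [inv_mul_cancel_left]⟩

lemma keyK {s t : B} {q : ArtinGroup M} (hs : dv (σ M s) q) (ht : dv (σ M t) q) :
    dv (sim (altProd (M.simple s) (M.simple t) (M s t))) q := by
  have hq : q ∈ PP M := by
    have := mul_mem (σ_mem_PP s) hs
    rwa [mul_inv_cancel_left] at this
  obtain ⟨x, rfl⟩ := hq
  rw [← sim_simple] at hs ht
  have := altProd_pre (dv_alp hs) (dv_alp ht) (M s t)
  exact dv_trans (sim_dv.mpr this) (alp_dv x)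

/-- Central element. -/
noncomputable def zc : ArtinGroup M := thet zz

lemma zc_mem : (zc : ArtinGroup M) ∈ PP M := ⟨_, rfl⟩

lemma zc_central (a : ArtinGroup M) : a * zc = zc * a := by
  have h : a ∈ Subgroup.closure (Set.range (σ M)) := by rw [ag_closure]; trivial
  change Commute a zc
  induction h using Subgroup.closure_induction with
  | mem x hx =>
    obtain ⟨s, rfl⟩ := hx
    rw [← thet_gen]
    exact (show Commute (gen M s) zz from zz_central _).map thet
  | one => exact Commute.one_left _
  | mul x y _ _ hx hy => exact hx.mul_left hy
  | inv x _ hx => exact hx.inv_left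

lemma zc_comm (a : ArtinGroup M) (k : ℕ) : a * zc ^ k = zc ^ k * a :=
  (show Commute a zc from zc_central a).pow_right k

lemma exists_pos (a : ArtinGroup M) : ∃ k : ℕ, zc ^ k * a ∈ PP M := by
  have h : a ∈ Subgroup.closure (Set.range (σ M)) := by rw [ag_closure]; trivial
  have step : ∀ s : B, (zc : ArtinGroup M) * (σ M s)⁻¹ ∈ PP M := by
    intro s
    obtain ⟨y, hy⟩ := zz_left (M := M) s
    refine ⟨y, ?_⟩
    unfold zc; rw [hy, map_mul, thet_gen, mul_inv_cancel_right]
  induction h using Subgroup.closure_induction_left with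
  | one => exact ⟨0, by simp [one_mem]⟩
  | mul_left x hx y _ ih =>
    obtain ⟨s, rfl⟩ := hx
    obtain ⟨k, hk⟩ := ih
    refine ⟨k, ?_⟩
    rw [← mul_assoc, ← zc_comm, mul_assoc]
    exact mul_mem (σ_mem_PP s) hk
  | inv_mul_cancel x hx y _ ih =>
    obtain ⟨s, rfl⟩ := hx
    obtain ⟨k, hk⟩ := ih
    refine ⟨k + 1, ?_⟩
    have : zc ^ (k + 1) * ((σ M s)⁻¹ * y) = (zc * (σ M s)⁻¹) * (zc ^ k * y) := by
      rw [pow_succ', mul_assoc, mul_assoc]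
      congr 1
      rw [← mul_assoc, ← mul_assoc, zc_comm]
    rw [this]
    exact mul_mem (step s) hk

lemma exists_pos_ge {a : ArtinGroup M} {k n : ℕ} (h : zc ^ k * a ∈ PP M) (hn : k ≤ n) :
    zc ^ n * a ∈ PP M := by
  obtain ⟨j, rfl⟩ := Nat.exists_eq_add_of_le' hn
  rw [pow_add, mul_assoc]
  exact mul_mem (pow_mem zc_mem j) h

lemma exists_lower (a b : ArtinGroup M) : ∃ x, dv x a ∧ dv x b := by
  obtain ⟨k, hk⟩ := exists_pos a
  obtain ⟨j, hj⟩ := exists_pos b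
  refine ⟨(zc ^ (k + j))⁻¹, ?_, ?_⟩
  · unfold dv; rw [inv_inv]; exact exists_pos_ge hk (by omega)
  · unfold dv; rw [inv_inv]; exact exists_pos_ge hj (by omega)

lemma exists_mt (p q : ArtinGroup M) : ∃ m, dv m p ∧ dv m q ∧ ∀ d, dv d p → dv d q → dv d m := by
  have key := meet_exists_aux (α := ArtinGroup M) dv
    (fun x y => ∃ s, y = x * σ M s) ln
    (fun x y z => dv_trans) dv_refl
    (by rintro x y ⟨s, rfl⟩; simp)
    (by rintro x y ⟨s, rfl⟩; exact dv_mul (σ_mem_PP s))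
    (fun x y => dv_ln)
    (by
      intro x p h
      unfold dv at h
      obtain ⟨l, h1, -⟩ := PP_list h
      cases l with
      | nil =>
        left
        simp only [List.map_nil, List.prod_nil] at h1
        exact inv_mul_eq_one.mp h1.symm
      | cons s l =>
        right
        refine ⟨_, ⟨s, rfl⟩, ?_⟩
        rw [List.map_cons, List.prod_cons] at h1
        unfold dv
        rw [mul_inv_rev, mul_assoc, ← h1, inv_mul_cancel_left]
        exact Pp_le Set.univ (list_Pp (by simp)))
    (by
      rintro x y₁ y₂ p₀ ⟨s, rfl⟩ ⟨t, rfl⟩ - -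
      by_cases hst : s = t
      · subst hst
        exact ⟨_, dv_refl _, dv_refl _, fun p h _ => h⟩
      refine ⟨x * sim (altProd (M.simple s) (M.simple t) (M s t)), ?_, ?_, ?_⟩
      · rw [dv_mul_left, ← sim_simple, sim_dv]; exact simple_pre_altProd hst
      · rw [dv_mul_left, ← sim_simple, sim_dv]; exact simple_pre_altProd' hst
      · intro p h1 h2
        have e : p = x * (x⁻¹ * p) := by group
        rw [e, dv_mul_left] at h1 h2 ⊢
        exact keyK h1 h2)
  obtain ⟨x, hxp, hxq⟩ := exists_lower p q
  obtain ⟨m, h1, h2, h3, h4⟩ := key x p q hxp hxq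
  refine ⟨m, h2, h3, ?_⟩
  intro d hdp hdq
  obtain ⟨y, hyd, hyx⟩ := exists_lower d x
  obtain ⟨m', h1', h2', h3', h4'⟩ := key y p q (dv_trans hyd hdp) (dv_trans hyd hdq)
  have a1 := h4' x hyx hxp hxq
  have a2 := h4' d hyd hdp hdq
  exact dv_trans a2 (h4 m' a1 h2' h3')

noncomputable def mt (p q : ArtinGroup M) : ArtinGroup M := (exists_mt p q).choose

lemma mt_left (p q : ArtinGroup M) : dv (mt p q) p := (exists_mt p q).choose_spec.1

lemma mt_right (p q : ArtinGroup M) : dv (mt p q) q := (exists_mt p q).choose_spec.2.1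

lemma dv_mt {p q d : ArtinGroup M} (h : dv d p) (h' : dv d q) : dv d (mt p q) :=
  (exists_mt p q).choose_spec.2.2 d h h'

lemma mt_mul (g p q : ArtinGroup M) : mt (g * p) (g * q) = g * mt p q := by
  apply dv_antisymm
  · have h1 := mt_left (g * p) (g * q)
    have h2 := mt_right (g * p) (g * q)
    have e : mt (g * p) (g * q) = g * (g⁻¹ * mt (g * p) (g * q)) := by group
    rw [e, dv_mul_left] at h1 h2 ⊢
    exact dv_mt h1 h2
  · exact dv_mt ((dv_mul_left g).mpr (mt_left p q)) ((dv_mul_left g).mpr (mt_right p q))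

lemma mt_PP {p q : ArtinGroup M} (hp : p ∈ PP M) (hq : q ∈ PP M) : mt p q ∈ PP M :=
  one_dv.mp (dv_mt (one_dv.mpr hp) (one_dv.mpr hq))

lemma Pp_of_dv {Y : Set B} {x y : ArtinGroup M} (hx : x ∈ PP M) (h : dv x y) (hy : y ∈ Pp M Y) :
    x ∈ Pp M Y ∧ x⁻¹ * y ∈ Pp M Y :=
  Pp_of_mul hx h (by rwa [mul_inv_cancel_left])

/-- `Δ_X`. -/
noncomputable def dX (X : Set B) : ArtinGroup M := sim (wl X)

lemma dX_mem (X : Set B) : (dX X : ArtinGroup M) ∈ Pp M X := sim_mem_AP (wl_mem X)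

lemma dX_conj {X : Set B} {s : B} (hs : s ∈ X) : ∃ s' ∈ X,
    σ M s * dX X = dX X * σ M s' ∧ σ M s' * dX X = dX X * σ M s := by
  obtain ⟨s', h, h1, h2⟩ := delta_conj (M := M) hs
  refine ⟨s', h, ?_, ?_⟩
  · have := congrArg thet h1; rwa [map_mul, map_mul] at this
  · have := congrArg thet h2; rwa [map_mul, map_mul] at this

lemma σ_dv_dX {X : Set B} {s : B} (hs : s ∈ X) : dv (σ M s) (dX X) := by
  rw [← sim_simple]
  exact sim_dv.mpr (pre_wl (simple_mem_WP hs))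

end Grp

end ArtinTits


namespace ArtinTits

section Swap

set_option linter.unusedSectionVars false

variable {B : Type*} {M : CoxeterMatrix B} [Finite M.Group]

lemma Pp_dX_conj {X : Set B} {a : ArtinGroup M} (ha : a ∈ Pp M X) :
    ∃ b ∈ Pp M X, a * dX X = dX X * b := by
  unfold Pp at ha
  induction ha using Submonoid.closure_induction with
  | mem x hx =>
    obtain ⟨s, hs, rfl⟩ := hx
    obtain ⟨s', hs', h1, -⟩ := dX_conj (M := M) hs
    exact ⟨_, σ_mem_Pp hs', h1⟩
  | one => exact ⟨1, one_mem _, by simp⟩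
  | mul x y _ _ hx hy =>
    obtain ⟨x', hx', ex⟩ := hx
    obtain ⟨y', hy', ey⟩ := hy
    exact ⟨x' * y', mul_mem hx' hy', by rw [mul_assoc, ey, ← mul_assoc, ex, mul_assoc]⟩

lemma Pp_dX_pow_conj {X : Set B} (n : ℕ) {a : ArtinGroup M} (ha : a ∈ Pp M X) :
    ∃ b ∈ Pp M X, a * dX X ^ n = dX X ^ n * b := by
  induction n generalizing a with
  | zero => exact ⟨a, ha, by simp⟩
  | succ n ih =>
    obtain ⟨b, hb, e⟩ := Pp_dX_conj ha
    obtain ⟨c, hc, e'⟩ := ih hb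
    exact ⟨c, hc, by rw [pow_succ', ← mul_assoc, e, mul_assoc, e', mul_assoc]⟩

lemma AP_dX_comm {X : Set B} {a : ArtinGroup M} (ha : a ∈ AP M X) : Commute a (dX X * dX X) := by
  unfold AP at ha
  induction ha using Subgroup.closure_induction with
  | mem x hx =>
    obtain ⟨s, hs, rfl⟩ := hx
    obtain ⟨s', hs', h1, h2⟩ := dX_conj (M := M) hs
    change _ * _ = _ * _
    rw [← mul_assoc, h1, mul_assoc, h2, mul_assoc]
  | one => exact Commute.one_left _
  | mul x y _ _ hx hy => exact hx.mul_left hy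
  | inv x _ hx => exact hx.inv_left

lemma AP_frac {X : Set B} {a : ArtinGroup M} (ha : a ∈ AP M X) :
    ∃ p ∈ Pp M X, ∃ q ∈ Pp M X, a = p⁻¹ * q := by
  have step : ∀ s ∈ X, ((dX X * dX X) * (σ M s)⁻¹ : ArtinGroup M) ∈ Pp M X := by
    intro s hs
    have h1 := (Pp_of_dv (M := M) (σ_mem_PP s) (σ_dv_dX (M := M) hs) (dX_mem X)).2
    have h2 := mul_mem h1 (dX_mem X)
    have h3 : (σ M s)⁻¹ * (dX X * dX X) = (dX X * dX X) * (σ M s)⁻¹ :=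
      (AP_dX_comm (X := X) (inv_mem (Pp_AP (σ_mem_Pp hs))))
    rwa [← h3, ← mul_assoc]
  have hz : (dX X * dX X : ArtinGroup M) ∈ Pp M X := mul_mem (dX_mem X) (dX_mem X)
  suffices H : a ∈ AP M X ∧ ∃ k : ℕ, (dX X * dX X) ^ k * a ∈ Pp M X by
    obtain ⟨-, k, hk⟩ := H
    exact ⟨_, pow_mem hz k, _, hk, by group⟩
  unfold AP at ha
  induction ha using Subgroup.closure_induction_left with
  | one => exact ⟨one_mem _, 0, by simp [one_mem]⟩
  | mul_left x hx y hy ih =>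
    obtain ⟨s, hs, rfl⟩ := hx
    obtain ⟨h, k, hk⟩ := ih
    have hs' := Pp_AP (σ_mem_Pp (M := M) hs)
    refine ⟨mul_mem hs' h, k, ?_⟩
    have e : σ M s * (dX X * dX X) ^ k = _ := (AP_dX_comm hs').pow_right k
    rw [← mul_assoc, ← e, mul_assoc]
    exact mul_mem (σ_mem_Pp hs) hk
  | inv_mul_cancel x hx y hy ih =>
    obtain ⟨s, hs, rfl⟩ := hx
    obtain ⟨h, k, hk⟩ := ih
    have hs' := inv_mem (Pp_AP (σ_mem_Pp (M := M) hs))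
    refine ⟨mul_mem hs' h, k + 1, ?_⟩
    have e : (σ M s)⁻¹ * (dX X * dX X) ^ k = _ := (AP_dX_comm hs').pow_right k
    rw [pow_succ', mul_assoc, ← mul_assoc _ _ y, ← e, mul_assoc _ _ y, ← mul_assoc]
    exact mul_mem (step s hs) hk

/-- The left denominator. -/
noncomputable def xx (a : ArtinGroup M) : ArtinGroup M := (mt 1 a)⁻¹

/-- Cyclic sliding (swap). -/
noncomputable def phi (a : ArtinGroup M) : ArtinGroup M := xx a * a * (xx a)⁻¹

lemma xx_frac {X : Set B} {p q : ArtinGroup M} (hp : p ∈ Pp M X) (hq : q ∈ Pp M X) :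
    xx (p⁻¹ * q) ∈ Pp M X ∧ xx (p⁻¹ * q) * (p⁻¹ * q) ∈ Pp M X := by
  have e : mt 1 (p⁻¹ * q) = p⁻¹ * mt p q := by
    rw [← mt_mul, inv_mul_cancel]
  have hm := mt_PP (Pp_le _ hp) (Pp_le _ hq)
  have h1 := (Pp_of_dv hm (mt_left p q) hp).2
  have h2 := (Pp_of_dv hm (mt_right p q) hq).2
  unfold xx
  rw [e]
  constructor
  · rwa [show (p⁻¹ * mt p q)⁻¹ = (mt p q)⁻¹ * p by group]
  · rwa [show (p⁻¹ * mt p q)⁻¹ * (p⁻¹ * q) = (mt p q)⁻¹ * q by group]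

lemma xx_AP {X : Set B} {a : ArtinGroup M} (ha : a ∈ AP M X) : xx a ∈ Pp M X := by
  obtain ⟨p, hp, q, hq, rfl⟩ := AP_frac ha
  exact (xx_frac hp hq).1

lemma xx_AP' {X : Set B} {a : ArtinGroup M} (ha : a ∈ AP M X) : xx a * a ∈ Pp M X := by
  obtain ⟨p, hp, q, hq, rfl⟩ := AP_frac ha
  exact (xx_frac hp hq).2

lemma phi_AP {X : Set B} {a : ArtinGroup M} (ha : a ∈ AP M X) : phi a ∈ AP M X :=
  mul_mem (mul_mem (Pp_AP (xx_AP ha)) ha) (inv_mem (Pp_AP (xx_AP ha)))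

lemma xx_push {a b g : ArtinGroup M} (hg : g ∈ PP M) (h : a * g = g * b) :
    xx a * g * (xx b)⁻¹ ∈ PP M := by
  have h1 : dv (mt 1 a) (g * mt 1 b) := by
    rw [← mt_mul, mul_one, ← h]
    exact dv_mt (dv_trans (mt_left _ _) (one_dv.mpr hg)) (dv_trans (mt_right _ _) (dv_mul hg))
  unfold dv at h1
  unfold xx
  rwa [inv_inv, mul_assoc]

lemma phi_push {a b g : ArtinGroup M} (h : a * g = g * b) :
    phi a * (xx a * g * (xx b)⁻¹) = (xx a * g * (xx b)⁻¹) * phi b := by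
  unfold phi
  calc _ = xx a * (a * g) * (xx b)⁻¹ := by group
    _ = _ := by rw [h]; group

/-- Iterated conjugator. -/
noncomputable def XX : ℕ → ArtinGroup M → ArtinGroup M
  | 0, _ => 1
  | n + 1, a => XX n (phi a) * xx a

lemma XX_conj (n : ℕ) (a : ArtinGroup M) : phi^[n] a * XX n a = XX n a * a := by
  induction n generalizing a with
  | zero => simp [XX]
  | succ n ih =>
    rw [Function.iterate_succ_apply, XX, ← mul_assoc, ih]
    unfold phi; group

lemma XX_AP {X : Set B} (n : ℕ) {a : ArtinGroup M} (ha : a ∈ AP M X) : XX n a ∈ Pp M X := by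
  induction n generalizing a with
  | zero => simp [XX, one_mem]
  | succ n ih => exact mul_mem (ih (phi_AP ha)) (xx_AP ha)

lemma XX_AP' {X : Set B} (n : ℕ) {a : ArtinGroup M} (ha : a ∈ AP M X) :
    XX (n + 1) a * a ∈ Pp M X := by
  rw [XX, mul_assoc]
  exact mul_mem (XX_AP n (phi_AP ha)) (xx_AP' ha)

lemma XX_push (n : ℕ) {a b g : ArtinGroup M} (hg : g ∈ PP M) (h : a * g = g * b) :
    XX n a * g * (XX n b)⁻¹ ∈ PP M := by
  induction n generalizing a b g with
  | zero => simpa [XX]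
  | succ n ih =>
    have := ih (xx_push hg h) (phi_push h)
    unfold XX
    rwa [show XX n (phi a) * xx a * g * (XX n (phi b) * xx b)⁻¹ =
      XX n (phi a) * (xx a * g * (xx b)⁻¹) * (XX n (phi b))⁻¹ by group]

lemma zc_mul (a b : ArtinGroup M) (k : ℕ) : a * (zc ^ k * b) = zc ^ k * (a * b) := by
  rw [← mul_assoc, zc_comm, mul_assoc]

lemma ln_phi (a : ArtinGroup M) : ln (phi a) = ln a := by
  unfold phi; simp

lemma phi_bound {a : ArtinGroup M} {k : ℕ} (h : zc ^ k * a ∈ PP M) : zc ^ k * phi a ∈ PP M := by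
  have h1 : zc ^ k * mt 1 a ∈ PP M := by
    rw [← mt_mul, mul_one]
    exact mt_PP (pow_mem zc_mem k) h
  have h2 : xx a * a ∈ PP M := mt_right 1 a
  have e : zc ^ k * phi a = xx a * a * (zc ^ k * mt 1 a) := by
    rw [← mul_assoc _ (zc ^ k), zc_comm, mul_assoc]
    congr 1
    unfold phi xx; rw [inv_inv]
  rw [e]
  exact mul_mem h2 h1

variable [Finite B]

lemma phi_periodic (a : ArtinGroup M) :
    ∃ i N : ℕ, 0 < N ∧ Function.IsPeriodicPt phi N (phi^[i] a) := by
  obtain ⟨k, hk⟩ := exists_pos a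
  have hF : {c : ArtinGroup M | zc ^ k * c ∈ PP M ∧ ln c = ln a}.Finite := by
    refine ((PP_finite (M := M) (ln ((zc : ArtinGroup M) ^ k) + ln a)).image
      (fun x => (zc ^ k)⁻¹ * x)).subset ?_
    rintro c ⟨h1, h2⟩
    exact ⟨zc ^ k * c, ⟨h1, by rw [ln_mul, h2]⟩, by group⟩
  have hmem : ∀ n : ℕ, phi^[n] a ∈ {c : ArtinGroup M | zc ^ k * c ∈ PP M ∧ ln c = ln a} := by
    intro n
    induction n with
    | zero => exact ⟨hk, rfl⟩
    | succ n ih =>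
      rw [Function.iterate_succ_apply']
      exact ⟨phi_bound ih.1, by rw [ln_phi]; exact ih.2⟩
  obtain ⟨i, j, hij, e⟩ : ∃ i j : ℕ, i < j ∧ phi^[i] a = phi^[j] a := by
    obtain ⟨i, j, hij, e⟩ := hF.exists_lt_map_eq_of_forall_mem hmem
    exact ⟨i, j, hij, e⟩
  refine ⟨i, j - i, by omega, ?_⟩
  unfold Function.IsPeriodicPt Function.IsFixedPt
  rw [← Function.iterate_add_apply, show j - i + i = j by omega, e]

lemma pow_push {Q Q' a b : ArtinGroup M} (hQ : a * Q = Q * a) (hQ' : b * Q' = Q' * b)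
    (H : ∀ g, g ∈ PP M → a * g = g * b → Q * g * Q'⁻¹ ∈ PP M)
    {g : ArtinGroup M} (hg : g ∈ PP M) (h : a * g = g * b) (n : ℕ) :
    Q ^ n * g * (Q' ^ n)⁻¹ ∈ PP M := by
  suffices Hs : Q ^ n * g * (Q' ^ n)⁻¹ ∈ PP M ∧
      a * (Q ^ n * g * (Q' ^ n)⁻¹) = (Q ^ n * g * (Q' ^ n)⁻¹) * b from Hs.1
  have c1 : Commute a Q := hQ
  have c2 : Commute b Q' := hQ'
  induction n with
  | zero => simpa using ⟨hg, h⟩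
  | succ n ih =>
    have e : Q ^ (n + 1) * g * (Q' ^ (n + 1))⁻¹ = Q * (Q ^ n * g * (Q' ^ n)⁻¹) * Q'⁻¹ := by
      rw [pow_succ', pow_succ']; group
    refine ⟨by rw [e]; exact H _ ih.1 ih.2, ?_⟩
    have c3 : a * Q ^ (n + 1) = Q ^ (n + 1) * a := c1.pow_right _
    have c4 : b * (Q' ^ (n + 1))⁻¹ = (Q' ^ (n + 1))⁻¹ * b := (c2.pow_right _).inv_right
    rw [← mul_assoc, ← mul_assoc, c3, mul_assoc _ a g, h]
    simp only [mul_assoc]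
    rw [c4]

lemma swap_aux {X : Set B} {a b g : ArtinGroup M} (ha : a ∈ AP M X) (hb : b ∈ AP M X)
    {N : ℕ} (hN : 0 < N) (pa : Function.IsPeriodicPt phi N a)
    (pb : Function.IsPeriodicPt phi N b) (hg : g ∈ PP M) (h : a * g = g * b) :
    ∃ Q ∈ Pp M X, ∃ P ∈ Pp M X, ∃ Q' ∈ Pp M X, ∃ P' ∈ Pp M X,
      a = Q⁻¹ * P ∧ b = Q'⁻¹ * P' ∧ Q * g = g * Q' ∧ P * g = g * P' := by
  have ca : a * XX N a = XX N a * a := by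
    have := XX_conj N a
    rwa [show phi^[N] a = a from pa] at this
  have cb : b * XX N b = XX N b * b := by
    have := XX_conj N b
    rwa [show phi^[N] b = b from pb] at this
  have h1 := pow_push ca cb (fun g hg h => XX_push N hg h) hg h
  obtain ⟨k, hk⟩ := exists_pos g⁻¹
  have h' : b * (zc ^ k * g⁻¹) = (zc ^ k * g⁻¹) * a := by
    have hb' : b = g⁻¹ * (a * g) := by rw [h]; group
    rw [zc_mul, mul_assoc (zc ^ k)]
    congr 1
    rw [hb']; group
  have h2 := pow_push cb ca (fun g hg h => XX_push N hg h) hk h'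
  have hmem : ∀ n : ℕ, XX N a ^ n * g * (XX N b ^ n)⁻¹ ∈
      {c : ArtinGroup M | c ∈ PP M ∧ ln c ≤ ln ((zc : ArtinGroup M) ^ k)} := by
    intro n
    refine ⟨h1 n, ?_⟩
    have := ln_nonneg (h2 n)
    simp only [ln_mul, ln_inv] at this ⊢
    linarith
  obtain ⟨i, j, hij, e⟩ := (PP_finite (M := M) _).exists_lt_map_eq_of_forall_mem hmem
  obtain ⟨n, rfl⟩ := Nat.exists_eq_add_of_lt hij
  obtain ⟨N, rfl⟩ := Nat.exists_eq_add_of_lt hN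
  rw [Nat.zero_add] at *
  have e1 : XX (N + 1) a ^ (n + 1) * g = g * XX (N + 1) b ^ (n + 1) := by
    rw [show i + n + 1 = i + (n + 1) by ring, pow_add _ i (n + 1), pow_add _ i (n + 1)] at e
    generalize XX (N + 1) a ^ i = p at e
    generalize XX (N + 1) b ^ i = q at e
    generalize XX (N + 1) b ^ (n + 1) = r at e ⊢
    generalize XX (N + 1) a ^ (n + 1) = t at e ⊢
    have e2 : p * (g * r) * (r⁻¹ * q⁻¹) = p * (t * g) * (r⁻¹ * q⁻¹) := by
      calc _ = p * g * q⁻¹ := by group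
        _ = _ := by rw [e]; group
    exact (mul_left_cancel (mul_right_cancel e2)).symm
  have hQ : ∀ c ∈ AP M X, XX (N + 1) c ^ (n + 1) * c ∈ Pp M X := by
    intro c hc
    rw [pow_succ, mul_assoc]
    exact mul_mem (pow_mem (XX_AP _ hc) _) (XX_AP' _ hc)
  refine ⟨_, pow_mem (XX_AP (N + 1) ha) (n + 1), _, hQ a ha, _, pow_mem (XX_AP (N + 1) hb) (n + 1),
    _, hQ b hb, by group, by group, e1, ?_⟩
  rw [mul_assoc, h, ← mul_assoc, e1, mul_assoc]

lemma swap {X : Set B} {a b g : ArtinGroup M} (ha : a ∈ AP M X) (hb : b ∈ AP M X)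
    (h : a * g = g * b) :
    ∃ x ∈ AP M X, ∃ y ∈ AP M X, ∃ g ∈ PP M,
    ∃ Q ∈ Pp M X, ∃ P ∈ Pp M X, ∃ Q' ∈ Pp M X, ∃ P' ∈ Pp M X,
      a = x⁻¹ * (Q⁻¹ * P) * x ∧ b = y⁻¹ * (Q'⁻¹ * P') * y ∧ Q * g = g * Q' ∧ P * g = g * P' := by
  have hAP : ∀ n : ℕ, ∀ c ∈ AP M X, phi^[n] c ∈ AP M X := by
    intro n
    induction n with
    | zero => intro c hc; exact hc
    | succ n ih => intro c hc; exact ih _ (phi_AP hc)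
  obtain ⟨i, N, hN, pa⟩ := phi_periodic a
  obtain ⟨j, N', hN', pb⟩ := phi_periodic b
  obtain ⟨k, hk⟩ := exists_pos (XX i a * g * (XX j b)⁻¹)
  have e1 := XX_conj i a
  have e2 := XX_conj j b
  obtain ⟨Q, hQ, P, hP, Q', hQ', P', hP', E1, E2, E3, E4⟩ := swap_aux (hAP i a ha) (hAP j b hb)
    (Nat.mul_pos hN hN') (pa.mul_const N') (pb.const_mul N) hk (by
      rw [zc_mul, mul_assoc (zc ^ k)]
      congr 1
      rw [← mul_assoc, ← mul_assoc, e1, mul_assoc _ a g, h]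
      have : phi^[j] b = XX j b * b * (XX j b)⁻¹ := by rw [← e2]; group
      rw [this]; group)
  refine ⟨_, Pp_AP (XX_AP i ha), _, Pp_AP (XX_AP j hb), _, hk, Q, hQ, P, hP, Q', hQ', P', hP',
    ?_, ?_, E3, E4⟩
  · rw [← E1, mul_assoc, e1]; group
  · rw [← E2, mul_assoc, e2]; group

end Swap

end ArtinTits


namespace ArtinTits

section Ribbon

set_option linter.unusedSectionVars false

variable {B : Type*} {M : CoxeterMatrix B} [Finite M.Group]

lemma dv_σ_of_mem {s : B} {x : ArtinGroup M} (h : dv (σ M s) x) : ∃ y ∈ PP M, x = σ M s * y :=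
  ⟨_, h, by group⟩

lemma ln_one_σ {x : ArtinGroup M} (h : x ∈ PP M) (h1 : ln x = 1) : ∃ t, x = σ M t := by
  obtain ⟨l, hl, hn⟩ := PP_list h
  obtain ⟨t, rfl⟩ := List.length_eq_one_iff.mp (show l.length = 1 by omega)
  exact ⟨t, by rw [← hl]; simp⟩

lemma σ_rr {Y : Set B} {s : B} (hs : s ∈ Y) : dv (sim (rr Y)) (σ M s * sim (rr Y)) := by
  obtain ⟨s', e⟩ := rr_conj (M := M) hs
  have h1 := rr_not (M := M) hs
  rw [pre_simple] at h1
  have h2 := len_sw s (rr Y : M.Group)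
  have h3 : len (M.simple s * rr Y : M.Group) = len (rr Y : M.Group) + 1 := by omega
  have e1 : sim (M.simple s * rr Y) = σ M s * sim (rr Y) := by
    rw [sim_mul (by rw [h3, len_simple, add_comm]), sim_simple]
  have e2 : sim (rr Y * M.simple s') = sim (rr Y) * σ M s' := by
    rw [sim_mul (by rw [← e, h3, len_simple]), sim_simple]
  rw [← e1, e, e2]
  exact dv_mul (σ_mem_PP _)

lemma C1 {Y : Set B} {s : B} (hs : s ∈ Y) {x : ArtinGroup M} (hx : x ∈ PP M) :
    ln (mt (σ M s * x) (sim (rr Y))) ≤ ln (mt x (sim (rr Y))) ∧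
    (ln (mt (σ M s * x) (sim (rr Y))) = ln (mt x (sim (rr Y))) →
      mt (σ M s * x) (sim (rr Y)) = mt x (sim (rr Y)) ∧
      ∃ t, σ M s * mt x (sim (rr Y)) = mt x (sim (rr Y)) * σ M t) := by
  have hR := sim_mem (rr Y : M.Group)
  have hb := mt_PP hx hR
  have hb' := mt_PP (mul_mem (σ_mem_PP s) hx) hR
  have h1 : dv (mt (σ M s * x) (sim (rr Y))) (σ M s * mt x (sim (rr Y))) := by
    rw [← mt_mul]
    exact dv_mt (mt_left _ _) (dv_trans (mt_right _ _) (σ_rr hs))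
  obtain ⟨w, hw, ew⟩ := sim_divisor hb (mt_right _ _)
  obtain ⟨w', hw', ew'⟩ := sim_divisor hb' (mt_right _ _)
  rw [ew, ew'] at h1 ⊢
  have nd : ∀ w : M.Group, pre w (rr Y) → ¬ pre (M.simple s) w :=
    fun w h h' => rr_not hs (pre_trans h' h)
  have n1 := nd w hw
  have n2 := nd w' hw'
  rw [pre_simple] at n1 n2
  have l1 := len_sw s w
  have l2 := len_sw s w'
  have e1 : sim (M.simple s * w) = σ M s * sim w := by
    rw [sim_mul (by rw [len_simple]; omega), sim_simple]
  have hle := dv_ln h1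
  have hne : ln (sim w') ≠ ln (σ M s * sim w) := by
    intro h
    have := dv_eq h1 h.ge
    rw [← e1] at this
    have := sim_inj this
    rw [this, ssw] at n2
    omega
  rw [ln_mul, ln_σ] at hle hne
  refine ⟨by omega, fun he => ?_⟩
  obtain ⟨t, ht⟩ := ln_one_σ h1 (by rw [ln_mul, ln_mul, ln_inv, ln_σ]; omega)
  have e2 : σ M s * sim w = sim w' * σ M t := by rw [← ht]; group
  have hww : w' = w := by
    have hp : pre w' (M.simple s * w) := by rw [← sim_dv, e1]; exact h1
    have hlen : len w = len w' := by
      rw [ln_sim, ln_sim] at he; omega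
    unfold pre at hp
    obtain ⟨v', hv, hv'⟩ := exch s w' (w'⁻¹ * (M.simple s * w)) (by
      rw [mul_inv_cancel_left]; omega) (by omega) (by
      rw [mul_inv_cancel_left, ssw]; omega)
    rw [mul_inv_cancel_left, ssw] at hv
    have : v' = 1 := len_eq_zero.mp (by omega)
    rw [hv, this, mul_one]
  subst hww
  exact ⟨rfl, t, e2⟩

lemma C2 {Y : Set B} {g : ArtinGroup M} (hg : g ∈ PP M) (l : List B) (hl : ∀ s ∈ l, s ∈ Y) :
    ln (mt ((l.map (σ M)).prod * g) (sim (rr Y))) ≤ ln (mt g (sim (rr Y))) ∧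
    (ln (mt ((l.map (σ M)).prod * g) (sim (rr Y))) = ln (mt g (sim (rr Y))) →
      mt ((l.map (σ M)).prod * g) (sim (rr Y)) = mt g (sim (rr Y)) ∧
      ∀ s ∈ l, ∃ t, σ M s * mt g (sim (rr Y)) = mt g (sim (rr Y)) * σ M t) := by
  induction l with
  | nil => simp
  | cons s l ih =>
    have ih' := ih (fun s hs => hl s (List.mem_cons_of_mem _ hs))
    have hx : (l.map (σ M)).prod * g ∈ PP M :=
      mul_mem (Pp_le Y (list_Pp fun s hs => hl s (List.mem_cons_of_mem _ hs))) hg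
    have hc := C1 (hl s List.mem_cons_self) hx
    rw [List.map_cons, List.prod_cons, mul_assoc]
    refine ⟨hc.1.trans ih'.1, fun he => ?_⟩
    obtain ⟨h1, h2⟩ := ih'.2 (le_antisymm ih'.1 (by rw [← he]; exact hc.1))
    obtain ⟨h3, h4⟩ := hc.2 (by rw [h1, he])
    rw [h1] at h3 h4
    refine ⟨h3, ?_⟩
    intro y hy
    rcases List.mem_cons.mp hy with rfl | hy
    · exact h4
    · exact h2 y hy

lemma map_conj {g : ArtinGroup M} (l : List B) (f : B → B)
    (h : ∀ s ∈ l, σ M s * g = g * σ M (f s)) :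
    (l.map (σ M)).prod * g = g * ((l.map f).map (σ M)).prod := by
  induction l with
  | nil => simp
  | cons s l ih =>
    simp only [List.map_cons, List.prod_cons]
    rw [mul_assoc, ih fun s hs => h s (List.mem_cons_of_mem _ hs), ← mul_assoc,
      h s List.mem_cons_self, mul_assoc]

lemma exists_fun {g : ArtinGroup M} (l : List B)
    (h : ∀ s ∈ l, ∃ t, σ M s * g = g * σ M t) :
    ∃ f : B → B, ∀ s ∈ l, σ M s * g = g * σ M (f s) := by
  classical
  choose! f hf using h
  exact ⟨f, hf⟩

lemma propC (n : ℕ) : ∀ (g : ArtinGroup M) (l : List B), g ∈ PP M → ln g ≤ n →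
    (∀ s ∈ l, ¬ dv (σ M s) g) → dv g ((l.map (σ M)).prod * g) →
    ∀ s ∈ l, ∃ t, σ M s * g = g * σ M t := by
  induction n with
  | zero =>
    intro g l hg hn _ _ s _
    have : g = 1 := ln_eq_zero hg (le_antisymm hn (ln_nonneg hg))
    exact ⟨s, by simp [this]⟩
  | succ n ih =>
    intro g l hg hn hnd hd
    by_cases hg1 : g = 1
    · intro s _
      exact ⟨s, by simp [hg1]⟩
    set Y : Set B := {s | s ∈ l} with hY
    have hR := sim_mem (rr Y : M.Group)
    have hα := mt_PP hg hR
    obtain ⟨c1, c2⟩ := C2 (Y := Y) hg l (fun s hs => hs)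
    have hle : ln (mt g (sim (rr Y))) ≤ ln (mt ((l.map (σ M)).prod * g) (sim (rr Y))) :=
      dv_ln (dv_mt (dv_trans (mt_left _ _) hd) (mt_right _ _))
    obtain ⟨-, c3⟩ := c2 (le_antisymm c1 hle)
    have hα1 : 1 ≤ ln (mt g (sim (rr Y))) := by
      obtain ⟨l', hl', -⟩ := PP_list hg
      cases l' with
      | nil => exact absurd hl'.symm hg1
      | cons t l' =>
        have ht : dv (σ M t) g := by
          rw [← hl', List.map_cons, List.prod_cons]
          exact dv_mul (Pp_le Set.univ (list_Pp fun _ _ => trivial))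
        have htY : t ∉ Y := fun h => hnd t h ht
        have : dv (σ M t) (sim (rr Y)) := by
          rw [← sim_simple]; exact sim_dv.mpr (rr_pre htY)
        have := dv_ln (dv_mt ht this)
        rwa [ln_σ] at this
    have hleft := mt_left g (sim (rr Y))
    generalize mt g (sim (rr Y)) = α at hα c3 hα1 hleft
    obtain ⟨f, hf⟩ := exists_fun l c3
    have hc := map_conj l f hf
    have e : g = α * (α⁻¹ * g) := by group
    have key := ih (α⁻¹ * g) (l.map f) hleft (by rw [ln_mul, ln_inv]; push_cast at hn; omega)
      (by
        intro s' hs' hdv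
        obtain ⟨s, hs, rfl⟩ := List.mem_map.mp hs'
        apply hnd s hs
        have h1 := (dv_mul_left α).mpr hdv
        rw [← hf s hs, mul_inv_cancel_left] at h1
        exact dv_trans (dv_mul hα) h1)
      (by
        rw [← dv_mul_left α, mul_inv_cancel_left, ← mul_assoc α, ← hc, mul_assoc,
          mul_inv_cancel_left]
        exact hd)
    intro s hs
    obtain ⟨t, ht⟩ := key (f s) (List.mem_map_of_mem hs)
    refine ⟨t, ?_⟩
    calc σ M s * g = σ M s * α * (α⁻¹ * g) := by group
      _ = α * (σ M (f s) * (α⁻¹ * g)) := by rw [hf s hs, mul_assoc]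
      _ = g * σ M t := by rw [ht]; group

lemma dv_dX_pow {X : Set B} (l : List B) (hl : ∀ s ∈ l, s ∈ X) :
    dv ((l.map (σ M)).prod) (dX X ^ l.length) := by
  induction l with
  | nil => simp [dv_refl]
  | cons s l ih =>
    have ih' := ih fun s hs => hl s (List.mem_cons_of_mem _ hs)
    have hs := hl s List.mem_cons_self
    have h1 := (Pp_of_dv (σ_mem_PP s) (σ_dv_dX (M := M) hs) (dX_mem X)).2
    obtain ⟨y', hy', e⟩ := Pp_dX_pow_conj l.length h1
    rw [List.map_cons, List.prod_cons, List.length_cons, pow_succ']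
    refine dv_trans ((dv_mul_left _).mpr ih') ?_
    have : dX X * dX X ^ l.length = σ M s * dX X ^ l.length * y' := by
      rw [mul_assoc, ← e]; group
    rw [this]
    exact dv_mul (Pp_le _ hy')

lemma ln_list (l : List B) : ln ((l.map (σ M)).prod) = l.length := by
  induction l with
  | nil => simp
  | cons s l ih => simp [ih]; ring

lemma dv_dX_pow' {X : Set B} {T : ArtinGroup M} (hT : T ∈ Pp M X) {n : ℕ} (h : ln T ≤ n) :
    dv T (dX X ^ n) := by
  obtain ⟨l, hl, rfl⟩ := Pp_list hT
  rw [ln_list] at h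
  refine dv_trans (dv_dX_pow l hl) ?_
  obtain ⟨k, rfl⟩ := Nat.exists_eq_add_of_le (show l.length ≤ n by omega)
  rw [pow_add]
  exact dv_mul (pow_mem (Pp_le _ (dX_mem X)) k)

lemma stepC {X : Set B} {g Q P Q' P' : ArtinGroup M} (hg : g ∈ PP M)
    (hQ : Q ∈ Pp M X) (hP : P ∈ Pp M X) (hQ' : Q' ∈ PP M) (hP' : P' ∈ PP M)
    (eQ : Q * g = g * Q') (eP : P * g = g * P') :
    ∃ h ∈ Pp M X, h⁻¹ * g ∈ PP M ∧ h⁻¹ * Q * h ∈ Pp M X ∧ h⁻¹ * P * h ∈ Pp M X ∧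
      ∀ s ∈ X, ¬ dv (σ M s) (h⁻¹ * g) := by
  set N := (ln g).toNat with hN
  have hNg : ln g = N := by have := ln_nonneg hg; omega
  have hd : (dX X ^ N : ArtinGroup M) ∈ Pp M X := pow_mem (dX_mem X) N
  have hm := mt_PP hg (Pp_le _ hd)
  have hh := (Pp_of_dv hm (mt_right _ _) hd).1
  have key : ∀ T ∈ Pp M X, ∀ T' ∈ PP M, T * g = g * T' →
      (mt g (dX X ^ N))⁻¹ * T * mt g (dX X ^ N) ∈ Pp M X := by
    intro T hT T' hT' e
    have h1 : dv (mt g (dX X ^ N)) (T * mt g (dX X ^ N)) := by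
      rw [← mt_mul]
      refine dv_mt ?_ ?_
      · rw [e]; exact dv_trans (mt_left _ _) (dv_mul hT')
      · obtain ⟨b, hb, e'⟩ := Pp_dX_pow_conj N hT
        rw [e']; exact dv_trans (mt_right _ _) (dv_mul (Pp_le _ hb))
    have := (Pp_of_dv hm h1 (mul_mem hT hh)).2
    rwa [← mul_assoc] at this
  refine ⟨_, hh, mt_left _ _, key Q hQ Q' hQ' eQ, key P hP P' hP' eP, ?_⟩
  intro s hs hdv
  have h1 := (dv_mul_left (mt g (dX X ^ N))).mpr hdv
  rw [mul_inv_cancel_left] at h1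
  have h2 := dv_dX_pow' (mul_mem hh (σ_mem_Pp hs)) (by rw [← hNg]; exact dv_ln h1)
  have h3 := dv_ln (dv_mt h1 h2)
  rw [ln_mul, ln_σ] at h3
  omega

lemma letters_mem {X : Set B} (l : List B) (h : (l.map (σ M)).prod ∈ Pp M X) :
    ∀ s ∈ l, s ∈ X := by
  induction l with
  | nil => simp
  | cons s l ih =>
    rw [List.map_cons, List.prod_cons] at h
    obtain ⟨h1, h2⟩ := Pp_of_mul (σ_mem_PP s) (Pp_le Set.univ (list_Pp fun _ _ => trivial)) h
    intro y hy
    rcases List.mem_cons.mp hy with rfl | hy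
    · exact σ_mem_Pp_iff.mp h1
    · exact ih h2 y hy

lemma sim_conj {v : M.Group} {y y' : B} (h : M.simple y * v = v * M.simple y') :
    σ M y * sim v = sim v * σ M y' := by
  rcases len_sw y v with h1 | h1
  · rw [← sim_simple, ← sim_simple, ← sim_mul (by rw [len_simple]; omega),
      ← sim_mul (by rw [len_simple, ← h]; omega), h]
  ·
    have e1 : v = M.simple y * (M.simple y * v) := by rw [ssw]
    have e2 : v = (M.simple y * v) * M.simple y' := by rw [h, mul_assoc, ss, mul_one]
    have f1 : sim v = σ M y * sim (M.simple y * v) := by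
      rw [← sim_simple, ← sim_mul, ssw]
      rw [ssw, len_simple]; omega
    have f2 : sim v = sim (M.simple y * v) * σ M y' := by
      rw [← sim_simple, ← sim_mul, ← e2]
      rw [← e2, len_simple]; omega
    nth_rewrite 1 [f2]
    nth_rewrite 1 [f1]
    rw [mul_assoc]

end Ribbon

end ArtinTits


namespace ArtinTits

section Final

variable {B : Type*} {M : CoxeterMatrix B} [Finite M.Group]

/-- Projection to the Coxeter group. -/
noncomputable def prj : ArtinGroup M →* M.Group :=
  agLift M.simple (fun s t _ => altProd_eq_simple s t)

lemma prj_σ (s : B) : prj (σ M s) = M.simple s := agLift_σ _ _ s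

lemma Pp_conj_eq {Y : Set B} {f g c : ArtinGroup M} (hc : c ∈ Pp M Y)
    (h : ∀ s ∈ Y, f⁻¹ * σ M s * f = g⁻¹ * σ M s * g) : f⁻¹ * c * f = g⁻¹ * c * g := by
  unfold Pp at hc
  induction hc using Submonoid.closure_induction with
  | mem x hx =>
    obtain ⟨s, hs, rfl⟩ := hx
    exact h s hs
  | one => simp
  | mul x y _ _ hx hy =>
    calc f⁻¹ * (x * y) * f = (f⁻¹ * x * f) * (f⁻¹ * y * f) := by group
      _ = g⁻¹ * (x * y) * g := by rw [hx, hy]; group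

lemma stepD {X : Set B} (hstar : StarW M X) {g Q P Q' P' : ArtinGroup M} (hg : g ∈ PP M)
    (hQ : Q ∈ Pp M X) (hP : P ∈ Pp M X) (hQ' : Q' ∈ Pp M X) (hP' : P' ∈ Pp M X)
    (eQ : Q * g = g * Q') (eP : P * g = g * P') (hred : ∀ s ∈ X, ¬ dv (σ M s) g) :
    ∃ f ∈ AP M X, f⁻¹ * Q * f = Q' ∧ f⁻¹ * P * f = P' := by
  obtain ⟨L, hLX, hL⟩ := Pp_list (mul_mem hP hQ)
  have eT : (L.map (σ M)).prod * g = g * (P' * Q') := by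
    rw [hL, mul_assoc, eQ, ← mul_assoc, eP, mul_assoc]
  have hC := propC (ln g).toNat g L hg (by have := ln_nonneg hg; omega)
    (fun s hs => hred s (hLX s hs))
    (by rw [eT]; exact dv_mul (mul_mem (Pp_le _ hP') (Pp_le _ hQ')))
  obtain ⟨φ, hφ⟩ := exists_fun L hC
  have hmap := map_conj L φ hφ
  rw [eT] at hmap
  have hφX := letters_mem (X := X) (L.map φ) (by
    rw [← mul_left_cancel hmap]; exact mul_mem hP' hQ')
  set Y : Set B := {s | s ∈ L} with hY
  have hw : ∀ s ∈ Y, (prj g)⁻¹ * M.simple s * prj g = M.simple (φ s) := by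
    intro s hs
    have := congrArg prj (hφ s hs)
    rw [map_mul, map_mul, prj_σ, prj_σ] at this
    rw [mul_assoc, this, inv_mul_cancel_left]
  obtain ⟨v, hv, hvY⟩ := hstar Y (φ '' Y) (fun s hs => hLX s hs)
    (by
      rintro _ ⟨s, hs, rfl⟩
      exact hφX _ (List.mem_map_of_mem hs))
    (prj g) (by
      rw [Set.image_image, Set.image_image]
      exact Set.image_congr hw)
  have hconj : ∀ s ∈ Y, (sim v)⁻¹ * σ M s * sim v = g⁻¹ * σ M s * g := by
    intro s hs
    have h1 : M.simple s * v = v * M.simple (φ s) := by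
      rw [← hw s hs, ← hvY s hs]; group
    rw [mul_assoc, sim_conj h1, inv_mul_cancel_left, mul_assoc, hφ s hs, inv_mul_cancel_left]
  have hPQ : P * Q ∈ Pp M Y := by rw [← hL]; exact list_Pp fun s hs => hs
  obtain ⟨hPY, hQY⟩ := Pp_of_mul (Pp_le _ hP) (Pp_le _ hQ) hPQ
  refine ⟨sim v, Pp_AP (sim_mem_AP hv), ?_, ?_⟩
  · rw [Pp_conj_eq hQY hconj, mul_assoc, eQ, inv_mul_cancel_left]
  · rw [Pp_conj_eq hPY hconj, mul_assoc, eP, inv_mul_cancel_left]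

end Final

end ArtinTits


namespace ArtinTits

/-- Proposition 1 of the paper: Property `⋆_W` implies conjugacy stability of `A_X` in `A_S`. -/
theorem conjugacy_stable_of_starW
    {B : Type*} [Finite B] (M : CoxeterMatrix B) [Finite M.Group]
    (hconn : ConnectedIn M Set.univ)
    (X : Set B) (hX : X.Nonempty) (hXproper : X ≠ Set.univ)
    (hstar : StarW M X) :
    IsConjugacyStable (AP M X) := by
  rintro a b ha hb ⟨g₀, hg₀⟩
  obtain ⟨x, hx, y, hy, g, hg, Q, hQ, P, hP, Q', hQ', P', hP', ea, eb, eQ, eP⟩ :=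
    swap ha hb (g := g₀) (by rw [← hg₀]; group)
  obtain ⟨h, hh, hg1, hQ1, hP1, hred⟩ := stepC hg hQ hP (Pp_le _ hQ') (Pp_le _ hP') eQ eP
  obtain ⟨f, hf, fQ, fP⟩ := stepD hstar hg1 hQ1 hP1 hQ' hP'
    (by rw [mul_assoc h⁻¹ g, ← eQ]; group) (by rw [mul_assoc h⁻¹ g, ← eP]; group) hred
  refine ⟨x⁻¹ * h * f * y, mul_mem (mul_mem (mul_mem (inv_mem hx) (Pp_AP hh)) hf) hy, ?_⟩
  rw [ea, eb, ← fQ, ← fP]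
  group

end ArtinTits
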